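/- Let m ≥ 2, n ≥ 1 be integers, d = m + n, and let p ∈ [4, ∞). There is a constant C = C(m,n,p) > 0 such that for every λ ≥ 1 and every g : ℝ^m×(1/λ)ℤⁿ → ℂ, one has the global-in-time Sobolev–Strichartz estimate ‖U_λ g‖_{L^p(ℝ^m×𝕋ⁿ_λ×ℝ)} ≤ C (∫ (1+|k|²)^{d/2 − (d+2)/p} |g(k)|² (dk)_λ)^{1/2}, the right-hand side being the H^{d/2−(d+2)/p} norm of the function with Fourier data g. -/

import Mathlib

noncomputable section
open MeasureTheory
open scoped ENNReal NNReal Classical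

/-- `|k|` for `k = (ζ, j/λ) ∈ ℝ^m × (1/λ)ℤⁿ`. -/
def freqNorm (lam : ℝ) {m n : ℕ} (ζ : Fin m → ℝ) (j : Fin n → ℤ) : ℝ :=
  Real.sqrt ((∑ i, (ζ i) ^ 2) + ∑ i, ((j i : ℝ) / lam) ^ 2)

/-- The free Schrödinger wave `(U_λ g)(t, x, y) = ∫ g(k) e^{i(z·k − t|k|²)} (dk)_λ`
on `ℝ^m × 𝕋ⁿ_λ`, where `g ζ j` stands for `g (ζ, j/λ)`. -/
def waveU (lam : ℝ) {m n : ℕ} (g : (Fin m → ℝ) → (Fin n → ℤ) → ℂ)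
    (t : ℝ) (x : Fin m → ℝ) (y : Fin n → ℝ) : ℂ :=
  ((1 / lam ^ n : ℝ) : ℂ) * ∑' j : Fin n → ℤ, ∫ ζ : Fin m → ℝ,
    g ζ j * Complex.exp (Complex.I *
      ((((∑ i, x i * ζ i) + ∑ i, y i * ((j i : ℝ) / lam))
        - t * ((∑ i, (ζ i) ^ 2) + ∑ i, ((j i : ℝ) / lam) ^ 2) : ℝ) : ℂ))

/-- Squared `L²_λ` norm of Fourier data on `ℝ^m × (1/λ)ℤⁿ`. -/
def l2sq (lam : ℝ) {m n : ℕ} (g : (Fin m → ℝ) → (Fin n → ℤ) → ℂ) : ℝ≥0∞ :=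
  ENNReal.ofReal (1 / lam ^ n) * ∑' j : Fin n → ℤ, ∫⁻ ζ : Fin m → ℝ, (‖g ζ j‖₊ : ℝ≥0∞) ^ 2

/-- `N` is a dyadic integer, i.e. `N ∈ 2^ℕ`. -/
def IsDyadic (N : ℝ) : Prop := ∃ a : ℕ, N = 2 ^ a

/-- `g` is supported in `{k : |k| ≤ 2N, and moreover |k| ≥ N/2 when N > 1}`. -/
def SuppIn (lam : ℝ) {m n : ℕ} (g : (Fin m → ℝ) → (Fin n → ℤ) → ℂ) (N : ℝ) : Prop :=
  ∀ ζ j, g ζ j ≠ 0 → freqNorm lam ζ j ≤ 2 * N ∧ (1 < N → N / 2 ≤ freqNorm lam ζ j)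

/-- One period box of the torus `𝕋ⁿ_λ`. -/
def torusBox (lam : ℝ) (n : ℕ) : Set (Fin n → ℝ) :=
  Set.Icc 0 (fun _ => 2 * Real.pi * lam)


lemma enn_two_mul_le (a b : ℝ≥0) : (2:ℝ≥0∞) * ((a:ℝ≥0∞) * b) ≤ (a:ℝ≥0∞)^2 + (b:ℝ≥0∞)^2 := by
  have : 2 * (a * b) ≤ a^2 + b^2 := by
    have := two_mul_le_add_sq a b
    linarith [this, mul_assoc 2 a b]
  exact_mod_cast this

theorem tt_star {Z Ω : Type*} [MeasurableSpace Z] [MeasurableSpace Ω]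
    (ν : Measure Z) [SFinite ν] (μ : Measure Ω) [SFinite μ]
    (e : Z → Ω → ℂ) (he : Measurable (Function.uncurry e))
    (ρ : Z → ℝ) (hρ : Integrable (fun z => ρ z ^ 2) ν) (hbd : ∀ z ω, ‖e z ω‖ ≤ ρ z)
    (Ψ : Ω → ℂ) (hΨm : Measurable Ψ) (hΨ : Integrable Ψ μ)
    (S : Set Ω) (hS : MeasurableSet S) (hsupp : ∀ ω, ω ∉ S → Ψ ω = 0) (A : ℝ≥0∞)
    (hA : ∀ ω, ∫⁻ ω' in S, ‖∫ z, e z ω * (starRingEnd ℂ) (e z ω') ∂ν‖ₑ ∂μ ≤ A) :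
    ∫⁻ z, ‖∫ ω, Ψ ω * e z ω ∂μ‖ₑ ^ 2 ∂ν ≤ A * ∫⁻ ω, ‖Ψ ω‖ₑ ^ 2 ∂μ := by
  set F : Z → ℂ := fun z => ∫ ω, Ψ ω * e z ω ∂μ with hF
  set κ : Ω → Ω → ℂ := fun ω ω' => ∫ z, e z ω * (starRingEnd ℂ) (e z ω') ∂ν with hκ
  have hconj : Measurable (starRingEnd ℂ) := Complex.continuous_conj.measurable
  have hFm : StronglyMeasurable F := by
    apply StronglyMeasurable.integral_prod_right (f := fun z ω => Ψ ω * e z ω)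
    apply Measurable.stronglyMeasurable
    exact (hΨm.comp measurable_snd).mul he
  have hκm : Measurable (Function.uncurry κ) := by
    have : StronglyMeasurable (fun p : Ω × Ω => ∫ z, e z p.1 * (starRingEnd ℂ) (e z p.2) ∂ν) := by
      apply StronglyMeasurable.integral_prod_right
        (f := fun (p : Ω × Ω) z => e z p.1 * (starRingEnd ℂ) (e z p.2))
      apply Measurable.stronglyMeasurable
      apply Measurable.mul
      · exact he.comp (measurable_snd.prodMk (measurable_fst.comp measurable_fst))
      · exact hconj.comp (he.comp (measurable_snd.prodMk (measurable_snd.comp measurable_fst)))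
    exact this.measurable
  have hsym : ∀ ω ω', ‖κ ω ω'‖ₑ = ‖κ ω' ω‖ₑ := by
    intro ω ω'
    have : κ ω ω' = (starRingEnd ℂ) (κ ω' ω) := by
      simp only [hκ]
      rw [← integral_conj]
      congr 1; ext z; simp [mul_comm]
    rw [this]
    simp [enorm_eq_nnnorm]
  have hFF : ∀ z, F z * (starRingEnd ℂ) (F z) =
      ∫ q : Ω × Ω, (Ψ q.1 * e z q.1) * (starRingEnd ℂ) (Ψ q.2 * e z q.2) ∂(μ.prod μ) := by
    intro z
    rw [integral_prod_mul (fun ω => Ψ ω * e z ω) (fun ω => (starRingEnd ℂ) (Ψ ω * e z ω)),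
      integral_conj]
  have hIntg : Integrable (fun r : Z × (Ω × Ω) =>
      (Ψ r.2.1 * e r.1 r.2.1) * (starRingEnd ℂ) (Ψ r.2.2 * e r.1 r.2.2)) (ν.prod (μ.prod μ)) := by
    have h1 : Integrable (fun r : Z × (Ω × Ω) => ρ r.1 ^ 2 * (‖Ψ r.2.1‖ * ‖Ψ r.2.2‖))
        (ν.prod (μ.prod μ)) := hρ.mul_prod (hΨ.norm.mul_prod hΨ.norm)
    refine h1.mono' ?_ ?_
    · apply Measurable.aestronglyMeasurable
      have a1 : Measurable (fun r : Z × (Ω × Ω) => Ψ r.2.1 * e r.1 r.2.1) :=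
        (hΨm.comp (by fun_prop)).mul (he.comp (by fun_prop : Measurable (fun r : Z × (Ω × Ω) => (r.1, r.2.1))))
      have a2 : Measurable (fun r : Z × (Ω × Ω) => Ψ r.2.2 * e r.1 r.2.2) :=
        (hΨm.comp (by fun_prop)).mul (he.comp (by fun_prop : Measurable (fun r : Z × (Ω × Ω) => (r.1, r.2.2))))
      exact a1.mul (hconj.comp a2)
    · refine Filter.Eventually.of_forall fun r => ?_
      simp only [norm_mul, RCLike.norm_conj]
      have h2 := hbd r.1 r.2.1
      have h3 := hbd r.1 r.2.2
      have : ‖e r.1 r.2.1‖ * ‖e r.1 r.2.2‖ ≤ ρ r.1 * ρ r.1 :=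
        mul_le_mul h2 h3 (norm_nonneg _) ((norm_nonneg _).trans h2)
      calc _ = (‖Ψ r.2.1‖ * ‖Ψ r.2.2‖) * (‖e r.1 r.2.1‖ * ‖e r.1 r.2.2‖) := by ring
        _ ≤ (‖Ψ r.2.1‖ * ‖Ψ r.2.2‖) * (ρ r.1 * ρ r.1) := by gcongr
        _ = _ := by ring
  have hswap : ∫ z, F z * (starRingEnd ℂ) (F z) ∂ν =
      ∫ q : Ω × Ω, (Ψ q.1 * (starRingEnd ℂ) (Ψ q.2)) * κ q.1 q.2 ∂(μ.prod μ) := by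
    simp_rw [hFF]
    rw [integral_integral_swap hIntg]
    congr 1; ext q
    simp only [hκ]
    rw [← integral_const_mul]
    congr 1; ext z
    simp only [map_mul]; ring
  have hFi : Integrable (fun z => F z * (starRingEnd ℂ) (F z)) ν := by
    simp_rw [hFF]
    exact hIntg.integral_prod_left
  have hnorm : ∀ z, F z * (starRingEnd ℂ) (F z) = ((‖F z‖ ^ 2 : ℝ) : ℂ) := by
    intro z; rw [Complex.mul_conj, Complex.normSq_eq_norm_sq]
  have hL : ∫⁻ z, ‖F z‖ₑ ^ 2 ∂ν = ‖∫ z, F z * (starRingEnd ℂ) (F z) ∂ν‖ₑ := by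
    have hi2 : Integrable (fun z => ‖F z‖ ^ 2) ν := by
      have := hFi.norm
      simp_rw [hnorm] at this
      simpa using this
    simp_rw [hnorm]
    rw [integral_complex_ofReal]
    have h0 : 0 ≤ ∫ z, ‖F z‖ ^ 2 ∂ν := integral_nonneg fun z => by positivity
    have : ‖((∫ z, ‖F z‖ ^ 2 ∂ν : ℝ) : ℂ)‖ₑ = ENNReal.ofReal (∫ z, ‖F z‖ ^ 2 ∂ν) := by
      rw [← ofReal_norm, Complex.norm_real, Real.norm_of_nonneg h0]
    rw [this, ofReal_integral_eq_lintegral_ofReal hi2 (Filter.Eventually.of_forall fun z => by positivity)]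
    congr 1; ext z
    rw [ENNReal.ofReal_pow (norm_nonneg _), ofReal_norm]
  rw [hL, hswap]
  refine (enorm_integral_le_lintegral_enorm _).trans ?_
  set G : Ω × Ω → ℝ≥0∞ := fun q => ‖Ψ q.1‖ₑ ^ 2 * (S.indicator (fun _ => 1) q.2 * ‖κ q.1 q.2‖ₑ) with hG
  have hGm : Measurable G := by
    apply Measurable.mul
    · exact ((hΨm.comp measurable_fst).enorm.pow_const 2)
    · exact ((measurable_const.indicator hS).comp measurable_snd).mul hκm.enorm
  have hpt : ∀ q : Ω × Ω, 2 * ‖(Ψ q.1 * (starRingEnd ℂ) (Ψ q.2)) * κ q.1 q.2‖ₑ ≤ G q + G q.swap := by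
    intro q
    by_cases h1 : q.1 ∈ S
    · by_cases h2 : q.2 ∈ S
      · simp only [hG, Prod.fst_swap, Prod.snd_swap, Set.indicator_of_mem h1, Set.indicator_of_mem h2, one_mul,
          hsym q.2 q.1, enorm_mul]
        have := enn_two_mul_le ‖Ψ q.1‖₊ ‖Ψ q.2‖₊
        rw [← add_mul, ← mul_assoc]
        gcongr
        simpa [enorm_eq_nnnorm] using this
      · simp [hsupp _ h2]
    · simp [hsupp _ h1]
  have hGI : ∫⁻ q, G q ∂(μ.prod μ) ≤ A * ∫⁻ ω, ‖Ψ ω‖ₑ ^ 2 ∂μ := by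
    rw [lintegral_prod _ hGm.aemeasurable]
    rw [← lintegral_const_mul _ (hΨm.enorm.pow_const 2)]
    apply lintegral_mono
    intro ω
    simp only [hG]
    rw [lintegral_const_mul]
    · rw [mul_comm]
      gcongr
      refine le_trans (le_of_eq ?_) (hA ω)
      rw [← lintegral_indicator hS]
      congr 1; ext ω'
      by_cases h : ω' ∈ S <;> simp [h, hκ]
    · exact (measurable_const.indicator hS).mul (hκm.comp (measurable_const.prodMk measurable_id)).enorm
  have hGs : ∫⁻ q, G q.swap ∂(μ.prod μ) = ∫⁻ q, G q ∂(μ.prod μ) := lintegral_prod_swap G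
  have h2 : 2 * ∫⁻ q : Ω × Ω, ‖(Ψ q.1 * (starRingEnd ℂ) (Ψ q.2)) * κ q.1 q.2‖ₑ ∂(μ.prod μ)
      ≤ 2 * (A * ∫⁻ ω, ‖Ψ ω‖ₑ ^ 2 ∂μ) := by
    rw [← lintegral_const_mul' _ _ (by norm_num)]
    calc _ ≤ ∫⁻ q, G q + G q.swap ∂(μ.prod μ) := lintegral_mono hpt
      _ = ∫⁻ q, G q ∂(μ.prod μ) + ∫⁻ q, G q ∂(μ.prod μ) := by rw [lintegral_add_left hGm, hGs]
      _ ≤ _ := by rw [two_mul]; gcongr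
  exact (ENNReal.mul_le_mul_iff_right (by norm_num) (by norm_num)).1 h2

lemma polar2 (G : ℝ → ℝ≥0∞) (hG : Measurable G) :
    ∫⁻ p : ℝ × ℝ, G (2 * (p.1 ^ 2 + p.2 ^ 2)) ≤ ENNReal.ofReal (2 * Real.pi) * ∫⁻ r, G r := by
  rw [← lintegral_comp_polarCoord_symm]
  have h1 : ∀ p : ℝ × ℝ, ENNReal.ofReal p.1 • G (2 * ((polarCoord.symm p).1 ^ 2 + (polarCoord.symm p).2 ^ 2))
      = (ENNReal.ofReal p.1 * G (2 * p.1 ^ 2)) * 1 := by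
    intro p
    simp only [polarCoord_symm_apply, smul_eq_mul, mul_one]
    congr 3
    have := Real.sin_sq_add_cos_sq p.2
    linear_combination (p.1 ^ 2) * this
  simp_rw [h1]
  have h2 : polarCoord.target = Set.Ioi (0 : ℝ) ×ˢ Set.Ioo (-Real.pi) Real.pi := rfl
  have hm : Measurable (fun r : ℝ => ENNReal.ofReal r * G (2 * r ^ 2)) := by fun_prop
  rw [h2, Measure.volume_eq_prod, ← Measure.prod_restrict,
    lintegral_prod_mul hm.aemeasurable aemeasurable_const, mul_comm]
  have h3 : ∫⁻ _ in Set.Ioo (-Real.pi) Real.pi, (1 : ℝ≥0∞) = ENNReal.ofReal (2 * Real.pi) := by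
    simp [two_mul]
  rw [h3]
  apply mul_le_mul_right
  have h4 := lintegral_image_eq_lintegral_abs_deriv_mul (s := Set.Ioi (0:ℝ)) (f := fun r => 2 * r ^ 2)
    (f' := fun r => 4 * r) measurableSet_Ioi
    (fun x _ => by
      have := ((hasDerivAt_pow 2 x).const_mul 2).hasDerivWithinAt (s := Set.Ioi (0:ℝ))
      exact this.congr_deriv (by push_cast; ring))
    (fun x hx y hy hxy => by
      simp only [Set.mem_Ioi] at hx hy
      have : x ^ 2 = y ^ 2 := by simpa using hxy
      nlinarith [sq_nonneg (x - y), mul_pos hx hy, sq_nonneg (x+y)]) G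
  calc _ ≤ ∫⁻ x in Set.Ioi (0:ℝ), ENNReal.ofReal |4 * x| * G (2 * x ^ 2) := by
        apply setLIntegral_mono' measurableSet_Ioi
        intro x hx
        have hx' : (0:ℝ) < x := hx
        gcongr
        rw [abs_of_pos (by linarith)]; linarith
    _ = _ := h4.symm
    _ ≤ _ := setLIntegral_le_lintegral _ _

lemma polar2' (G : ℝ → ℝ≥0∞) (hG : Measurable G) (c d q : ℝ) :
    ∫⁻ a : ℝ, ∫⁻ b : ℝ, G (2 * ((a - c) ^ 2 + (b - d) ^ 2) + q)
      ≤ ENNReal.ofReal (2 * Real.pi) * ∫⁻ r, G r := by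
  have h1 := polar2 (fun r => G (r + q)) (by fun_prop)
  rw [lintegral_add_right_eq_self G q, Measure.volume_eq_prod, lintegral_prod _ (by fun_prop)] at h1
  refine le_trans (le_of_eq ?_) h1
  rw [← lintegral_sub_right_eq_self (fun a : ℝ => ∫⁻ b : ℝ, G (2 * (a ^ 2 + b ^ 2) + q)) c]
  congr 1; ext a
  exact lintegral_sub_right_eq_self (fun b : ℝ => G (2 * ((a - c) ^ 2 + b ^ 2) + q)) d

lemma lintegral_cons {k : ℕ} (f : (Fin (k + 1) → ℝ) → ℝ≥0∞) :
    ∫⁻ ζ, f ζ = ∫⁻ p : ℝ × (Fin k → ℝ), f (Fin.cons p.1 p.2 : Fin (k+1) → ℝ) := by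
  have h := (volume_preserving_piFinSuccAbove (fun _ : Fin (k+1) => ℝ) 0).symm
  rw [← h.lintegral_comp_emb (MeasurableEquiv.measurableEmbedding _)]
  congr 1; ext p
  congr 1
  simp [MeasurableEquiv.piFinSuccAbove, Fin.insertNthEquiv]

def cube (m : ℕ) (M : ℝ) : Set (Fin m → ℝ) := {ζ | ∀ i, |ζ i| ≤ M}

lemma cube_eq (m : ℕ) (M : ℝ) : cube m M = Set.Icc (fun _ => -M) (fun _ => M) := by
  ext ζ; simp [cube, Set.mem_Icc, Pi.le_def, abs_le, forall_and]

lemma measurableSet_cube (m : ℕ) (M : ℝ) : MeasurableSet (cube m M) := by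
  rw [cube_eq]; exact measurableSet_Icc

lemma volume_cube (m : ℕ) (M : ℝ) : volume (cube m M) = ENNReal.ofReal (2 * M) ^ m := by
  rw [cube_eq, Real.volume_Icc_pi]; simp [two_mul]

lemma cube_bound (k : ℕ) (M : ℝ) (G : ℝ → ℝ≥0∞) (hG : Measurable G) (c : Fin (k + 2) → ℝ) (q : ℝ) :
    ∫⁻ ζ in cube (k + 2) M, G (2 * ∑ i, (ζ i - c i) ^ 2 + q)
      ≤ ENNReal.ofReal (2 * M) ^ k * (ENNReal.ofReal (2 * Real.pi) * ∫⁻ r, G r) := by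
  rw [← lintegral_indicator (measurableSet_cube _ _), lintegral_cons]
  set h : ℝ → ℝ → (Fin k → ℝ) → ℝ≥0∞ := fun a b η => (cube k M).indicator (fun _ => 1) η *
    G (2 * ((a - c 0) ^ 2 + (b - c 1) ^ 2) + (2 * ∑ i : Fin k, (η i - c i.succ.succ) ^ 2 + q)) with hh
  have hhm : Measurable (fun r : ℝ × ℝ × (Fin k → ℝ) => h r.1 r.2.1 r.2.2) := by
    apply Measurable.mul
    · exact (measurable_const.indicator (measurableSet_cube k M)).comp (by fun_prop)
    · fun_prop
  have hle : ∀ a b η, (cube (k+2) M).indicator (fun ζ => G (2 * ∑ i, (ζ i - c i) ^ 2 + q))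
      (Fin.cons a (Fin.cons b η : Fin (k+1) → ℝ) : Fin (k+2) → ℝ) ≤ h a b η := by
    intro a b η
    by_cases hc : (Fin.cons a (Fin.cons b η : Fin (k+1) → ℝ) : Fin (k+2) → ℝ) ∈ cube (k+2) M
    · have hη : η ∈ cube k M := fun i => by simpa using hc i.succ.succ
      rw [Set.indicator_of_mem hc]
      simp only [hh, Set.indicator_of_mem hη, one_mul]
      apply le_of_eq
      congr 1
      simp only [Fin.sum_univ_succ, Fin.cons_zero, Fin.cons_succ, Fin.succ_zero_eq_one]
      ring
    · rw [Set.indicator_of_notMem hc]; exact zero_le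
  rw [Measure.volume_eq_prod]
  calc _ ≤ ∫⁻ a : ℝ, ∫⁻ η' : Fin (k+1) → ℝ, (cube (k+2) M).indicator (fun ζ => G (2 * ∑ i, (ζ i - c i) ^ 2 + q))
          (Fin.cons a η' : Fin (k+2) → ℝ) := lintegral_prod_le _
    _ ≤ ∫⁻ a : ℝ, ∫⁻ η : Fin k → ℝ, ∫⁻ b : ℝ, h a b η := by
        apply lintegral_mono; intro a
        dsimp only
        rw [lintegral_cons, Measure.volume_eq_prod]
        refine (lintegral_mono (g := fun p : ℝ × (Fin k → ℝ) => h a p.1 p.2) fun p => hle a p.1 p.2).trans ?_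
        exact le_of_eq (lintegral_prod_symm (fun p : ℝ × (Fin k → ℝ) => h a p.1 p.2) (hhm.comp (by fun_prop : Measurable (fun p : ℝ × (Fin k → ℝ) => (a, p)))).aemeasurable)
    _ = ∫⁻ η : Fin k → ℝ, ∫⁻ a : ℝ, ∫⁻ b : ℝ, h a b η := by
        apply lintegral_lintegral_swap
        apply Measurable.aemeasurable
        exact Measurable.lintegral_prod_right' (f := fun r : (ℝ × (Fin k → ℝ)) × ℝ => h r.1.1 r.2 r.1.2)
          (hhm.comp (by fun_prop : Measurable (fun r : (ℝ × (Fin k → ℝ)) × ℝ => (r.1.1, r.2, r.1.2))))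
    _ ≤ ∫⁻ η : Fin k → ℝ, (cube k M).indicator (fun _ => 1) η * (ENNReal.ofReal (2 * Real.pi) * ∫⁻ r, G r) := by
        apply lintegral_mono; intro η
        by_cases hη : η ∈ cube k M
        · simp only [hh, Set.indicator_of_mem hη, one_mul]
          exact polar2' G hG _ _ _
        · simp [hh, Set.indicator_of_notMem hη]
    _ = _ := by
        rw [lintegral_mul_const _ (measurable_const.indicator (measurableSet_cube k M)),
          lintegral_indicator (measurableSet_cube k M)]
        simp [volume_cube]

lemma euclid_bound (k : ℕ) (M : ℝ) (G : ℝ → ℝ≥0∞) (hG : Measurable G)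
    (H : (Fin (k+2) → ℝ) → ℝ≥0∞) (hH : Measurable H) (q : ℝ) :
    ∫⁻ ζ₂ in cube (k+2) M, ∫⁻ ζ₁ : Fin (k+2) → ℝ,
      H (ζ₁ + ζ₂) * G ((∑ i, ζ₁ i ^ 2) + (∑ i, ζ₂ i ^ 2) + q)
      ≤ (∫⁻ ξ, H ξ) * (ENNReal.ofReal (2 * M) ^ k * (ENNReal.ofReal (2 * Real.pi) * ∫⁻ r, G r)) := by
  calc _ = ∫⁻ ζ₂ in cube (k+2) M, ∫⁻ ξ : Fin (k+2) → ℝ,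
      H ξ * G ((∑ i, (ξ i - ζ₂ i) ^ 2) + (∑ i, ζ₂ i ^ 2) + q) := by
        congr 1; ext ζ₂
        rw [← lintegral_add_right_eq_self (fun ξ : Fin (k+2) → ℝ =>
          H ξ * G ((∑ i, (ξ i - ζ₂ i) ^ 2) + (∑ i, ζ₂ i ^ 2) + q)) ζ₂]
        simp
    _ = ∫⁻ ξ : Fin (k+2) → ℝ, ∫⁻ ζ₂ in cube (k+2) M,
      H ξ * G ((∑ i, (ξ i - ζ₂ i) ^ 2) + (∑ i, ζ₂ i ^ 2) + q) := by
        apply lintegral_lintegral_swap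
        apply Measurable.aemeasurable
        fun_prop
    _ ≤ ∫⁻ ξ : Fin (k+2) → ℝ, H ξ * (ENNReal.ofReal (2 * M) ^ k * (ENNReal.ofReal (2 * Real.pi) * ∫⁻ r, G r)) := by
        apply lintegral_mono; intro ξ
        dsimp only
        rw [lintegral_const_mul _ (by fun_prop)]
        gcongr
        refine le_trans (le_of_eq ?_) (cube_bound k M G hG (fun i => ξ i / 2) ((∑ i, ξ i ^ 2) / 2 + q))
        congr 1; ext ζ
        congr 1
        rw [← add_assoc]
        congr 1
        rw [Finset.mul_sum, Finset.sum_div, ← Finset.sum_add_distrib, ← Finset.sum_add_distrib]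
        congr 1; ext i; ring
    _ = _ := lintegral_mul_const _ hH

def gh (ε : ℝ) (τ : ℝ) : ℝ := Real.sqrt (Real.pi / ε) * Real.exp (-τ ^ 2 / (4 * ε))

lemma gh_nonneg (ε τ : ℝ) : 0 ≤ gh ε τ := by unfold gh; positivity

lemma gh_meas (ε : ℝ) : Measurable (gh ε) := by unfold gh; fun_prop

lemma gh_eq (ε : ℝ) : gh ε = fun τ => Real.sqrt (Real.pi / ε) * Real.exp (-(1 / (4 * ε)) * τ ^ 2) := by
  ext τ; unfold gh; congr 2; ring

lemma gh_integrable {ε : ℝ} (hε : 0 < ε) : Integrable (gh ε) := by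
  rw [gh_eq]
  exact (integrable_exp_neg_mul_sq (by positivity)).const_mul _

lemma gh_integral {ε : ℝ} (hε : 0 < ε) : ∫ τ, gh ε τ = 2 * Real.pi := by
  rw [gh_eq, integral_const_mul, integral_gaussian, ← Real.sqrt_mul (by positivity)]
  have : Real.pi / ε * (Real.pi / (1 / (4 * ε))) = (2 * Real.pi) ^ 2 := by field_simp; ring
  rw [this, Real.sqrt_sq (by positivity)]

lemma gh_lintegral {ε : ℝ} (hε : 0 < ε) : ∫⁻ τ, ENNReal.ofReal (gh ε τ) = ENNReal.ofReal (2 * Real.pi) := by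
  rw [← gh_integral hε, ofReal_integral_eq_lintegral_ofReal (gh_integrable hε)
    (Filter.Eventually.of_forall (gh_nonneg ε))]

lemma gh_lintegral_pi {ε : ℝ} (hε : 0 < ε) (m : ℕ) (ξ : Fin m → ℝ) :
    ∫⁻ ζ : Fin m → ℝ, ENNReal.ofReal (∏ i, gh ε (ζ i - ξ i)) = ENNReal.ofReal ((2 * Real.pi) ^ m) := by
  refine (lintegral_sub_right_eq_self (fun ζ : Fin m → ℝ => ENNReal.ofReal (∏ i, gh ε (ζ i))) ξ).trans ?_
  rw [← ofReal_integral_eq_lintegral_ofReal]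
  · congr 1
    rw [integral_fintype_prod_volume_eq_prod (fun _ => gh ε)]
    simp [gh_integral hε]
  · exact Integrable.fintype_prod (fun _ => gh_integrable hε)
  · exact Filter.Eventually.of_forall fun ζ => Finset.prod_nonneg fun i _ => gh_nonneg _ _

lemma gauss_ft {ε : ℝ} (hε : 0 < ε) (τ : ℝ) :
    ‖∫ x : ℝ, Complex.exp (Complex.I * ((x * τ : ℝ) : ℂ)) * ((Real.exp (-ε * x ^ 2) : ℝ) : ℂ)‖ = gh ε τ := by
  have h := fourierIntegral_gaussian (b := (ε : ℂ)) (by simpa using hε) (τ : ℂ)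
  have h1 : ∀ x : ℝ, Complex.exp (Complex.I * ((x * τ : ℝ) : ℂ)) * ((Real.exp (-ε * x ^ 2) : ℝ) : ℂ)
      = Complex.exp (Complex.I * τ * x) * Complex.exp (-(ε:ℂ) * x ^ 2) := by
    intro x; push_cast; congr 2; ring
  simp_rw [h1, h]
  unfold gh
  rw [norm_mul, Complex.norm_exp]
  congr 1
  · rw [← Complex.ofReal_div, Complex.norm_cpow_eq_rpow_re_of_pos (by positivity), Real.sqrt_eq_rpow]
    norm_num
  · congr 1
    have : -(τ:ℂ) ^ 2 / (4 * ε) = ((-τ ^ 2 / (4 * ε) : ℝ) : ℂ) := by push_cast; ring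
    rw [this, Complex.ofReal_re]

lemma torus_ft {lam : ℝ} (hl : 0 < lam) (j : ℤ) :
    ‖∫ y in Set.Icc 0 (2 * Real.pi * lam), Complex.exp (Complex.I * ((y * (j / lam) : ℝ) : ℂ))‖
      = if j = 0 then 2 * Real.pi * lam else 0 := by
  have hpos : 0 ≤ 2 * Real.pi * lam := by positivity
  rw [integral_Icc_eq_integral_Ioc, ← intervalIntegral.integral_of_le hpos]
  split_ifs with h
  · subst h; simp [abs_of_pos Real.pi_pos, abs_of_pos hl]
  · have h1 : ∀ y : ℝ, Complex.exp (Complex.I * ((y * (j / lam) : ℝ) : ℂ))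
      = Complex.exp ((Complex.I * (j / lam)) * y) := by
      intro y; push_cast; congr 1; ring
    simp_rw [h1]
    have hl' : (lam : ℂ) ≠ 0 := by exact_mod_cast hl.ne'
    have hj : (j : ℂ) ≠ 0 := by exact_mod_cast h
    rw [integral_exp_mul_complex (by simp [hj, hl'])]
    have h2 : Complex.I * (j / lam) * ((2 * Real.pi * lam : ℝ) : ℂ) = j * (2 * Real.pi * Complex.I) := by
      push_cast; field_simp
    rw [h2, Complex.exp_int_mul_two_pi_mul_I]
    simp

abbrev Fq (m n : ℕ) := (Fin n → ℤ) × (Fin m → ℝ)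
abbrev Sp (m n : ℕ) := ℝ × (Fin m → ℝ) × (Fin n → ℝ)

def muF (m n : ℕ) : Measure (Fq m n) := Measure.count.prod volume
def nuS (lam : ℝ) (m n : ℕ) : Measure (Sp m n) :=
  volume.prod (volume.prod (volume.restrict (torusBox lam n)))

instance (m n : ℕ) : SFinite (muF m n) := by unfold muF; infer_instance
instance (lam : ℝ) (m n : ℕ) : SFinite (nuS lam m n) := by unfold nuS; infer_instance

def sqk (lam : ℝ) {m n : ℕ} (k : Fq m n) : ℝ := (∑ i, (k.2 i) ^ 2) + ∑ i, ((k.1 i : ℝ) / lam) ^ 2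

def ee (lam : ℝ) {m n : ℕ} (z : Sp m n) (k : Fq m n) : ℂ :=
  Complex.exp (Complex.I *
      ((((∑ i, z.2.1 i * k.2 i) + ∑ i, z.2.2 i * ((k.1 i : ℝ) / lam))
        - z.1 * ((∑ i, (k.2 i) ^ 2) + ∑ i, ((k.1 i : ℝ) / lam) ^ 2) : ℝ) : ℂ))

def uu (lam : ℝ) {m n : ℕ} (g : Fq m n → ℂ) (z : Sp m n) : ℂ := ∫ k, g k * ee lam z k ∂(muF m n)

def rho (ε : ℝ) {m n : ℕ} (z : Sp m n) : ℝ :=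
  Real.exp (-(ε / 2) * z.1 ^ 2) * ∏ i, Real.exp (-(ε / 2) * (z.2.1 i) ^ 2)

lemma rho_nonneg (ε : ℝ) {m n : ℕ} (z : Sp m n) : 0 ≤ rho ε z := by
  unfold rho; positivity

lemma rho_sq (ε : ℝ) {m n : ℕ} (z : Sp m n) : rho ε z ^ 2 =
    Real.exp (-ε * z.1 ^ 2) * ((∏ i, Real.exp (-ε * (z.2.1 i) ^ 2)) * 1) := by
  unfold rho
  rw [mul_pow, ← Finset.prod_pow, mul_one, ← Real.exp_nat_mul]
  congr 1
  · congr 1; push_cast; ring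
  · congr 1; ext i; rw [← Real.exp_nat_mul]; congr 1; push_cast; ring

lemma box_finite (lam : ℝ) (n : ℕ) : IsFiniteMeasure ((volume : Measure (Fin n → ℝ)).restrict (torusBox lam n)) := by
  constructor
  rw [Measure.restrict_apply_univ]
  exact isCompact_Icc.measure_lt_top

lemma rho_integrable {ε : ℝ} (hε : 0 < ε) (lam : ℝ) (m n : ℕ) :
    Integrable (fun z : Sp m n => rho ε z ^ 2) (nuS lam m n) := by
  have := box_finite lam n
  simp_rw [rho_sq]
  unfold nuS
  have h1 : Integrable (fun x : ℝ => Real.exp (-ε * x ^ 2)) := integrable_exp_neg_mul_sq hε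
  have h2 : Integrable (fun x : Fin m → ℝ => ∏ i, Real.exp (-ε * (x i) ^ 2)) :=
    Integrable.fintype_prod (fun _ => h1)
  exact h1.mul_prod (h2.mul_prod (integrable_const (1:ℝ)))

lemma ee_norm (lam : ℝ) {m n : ℕ} (z : Sp m n) (k : Fq m n) : ‖ee lam z k‖ = 1 := by
  unfold ee; rw [mul_comm]; exact Complex.norm_exp_ofReal_mul_I _

lemma ee_meas_comp (lam : ℝ) {m n : ℕ} {α : Type*} [MeasurableSpace α] (f : α → Sp m n) (h : α → Fq m n)
    (hf : Measurable f) (hh : Measurable h) : Measurable (fun a => ee lam (f a) (h a)) := by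
  unfold ee
  have h1 : Measurable (fun a => (f a).1) := hf.fst
  have h2 : ∀ i, Measurable (fun a => (f a).2.1 i) := fun i => (measurable_pi_apply i).comp hf.snd.fst
  have h3 : ∀ i, Measurable (fun a => (f a).2.2 i) := fun i => (measurable_pi_apply i).comp hf.snd.snd
  have h4 : ∀ i, Measurable (fun a => (h a).2 i) := fun i => (measurable_pi_apply i).comp hh.snd
  have hj : ∀ i, Measurable (fun a => (((h a).1 i : ℤ) : ℝ)) := by
    intro i
    have h5 : Measurable (fun j : ℤ => (j:ℝ)) := measurable_from_top
    exact h5.comp ((measurable_pi_apply i).comp hh.fst)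
  fun_prop

lemma ee_meas (lam : ℝ) {m n : ℕ} : Measurable (fun r : Sp m n × Fq m n => ee lam r.1 r.2) :=
  ee_meas_comp lam (fun r : Sp m n × Fq m n => r.1) (fun r => r.2) measurable_fst measurable_snd

lemma kernel_eq {ε lam : ℝ} (hε : 0 < ε) (hl : 0 < lam) {m n : ℕ} (q q' : Fq m n × Fq m n) :
    ‖∫ z, (ee lam z q.1 * ee lam z q.2 * (rho ε z : ℂ)) *
      (starRingEnd ℂ) (ee lam z q'.1 * ee lam z q'.2 * (rho ε z : ℂ)) ∂(nuS lam m n)‖ =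
    gh ε (sqk lam q'.1 + sqk lam q'.2 - (sqk lam q.1 + sqk lam q.2)) *
     ((∏ i, gh ε ((q.1.2 i + q.2.2 i) - (q'.1.2 i + q'.2.2 i))) *
     (∏ i, if (q.1.1 i + q.2.1 i) - (q'.1.1 i + q'.2.1 i) = 0 then 2 * Real.pi * lam else 0)) := by
  set T := sqk lam q'.1 + sqk lam q'.2 - (sqk lam q.1 + sqk lam q.2) with hT
  set X : Fin m → ℝ := fun i => (q.1.2 i + q.2.2 i) - (q'.1.2 i + q'.2.2 i) with hX
  set J : Fin n → ℤ := fun i => (q.1.1 i + q.2.1 i) - (q'.1.1 i + q'.2.1 i) with hJ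
  have hpt : ∀ z : Sp m n, (ee lam z q.1 * ee lam z q.2 * (rho ε z : ℂ)) *
      (starRingEnd ℂ) (ee lam z q'.1 * ee lam z q'.2 * (rho ε z : ℂ)) =
      (Complex.exp (Complex.I * ((z.1 * T : ℝ) : ℂ)) * ((Real.exp (-ε * z.1 ^ 2) : ℝ) : ℂ)) *
      ((∏ i, (Complex.exp (Complex.I * ((z.2.1 i * X i : ℝ) : ℂ)) * ((Real.exp (-ε * (z.2.1 i) ^ 2) : ℝ) : ℂ))) *
       (∏ i, Complex.exp (Complex.I * ((z.2.2 i * (J i / lam) : ℝ) : ℂ)))) := by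
    intro z
    have h1 : ((rho ε z : ℝ) : ℂ) * (rho ε z : ℝ) = ((Real.exp (-ε * z.1 ^ 2) : ℝ) : ℂ) *
        ∏ i, ((Real.exp (-ε * (z.2.1 i) ^ 2) : ℝ) : ℂ) := by
      rw [← Complex.ofReal_mul, ← pow_two, rho_sq, mul_one, Complex.ofReal_mul, Complex.ofReal_prod]
    have h2 : ee lam z q.1 * ee lam z q.2 * (starRingEnd ℂ (ee lam z q'.1) * starRingEnd ℂ (ee lam z q'.2))
        = Complex.exp (Complex.I * ((z.1 * T : ℝ) : ℂ)) * ((∏ i, Complex.exp (Complex.I * ((z.2.1 i * X i : ℝ) : ℂ)))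
          * (∏ i, Complex.exp (Complex.I * ((z.2.2 i * (J i / lam) : ℝ) : ℂ)))) := by
      rw [← Complex.exp_sum, ← Complex.exp_sum, ← Complex.exp_add, ← Complex.exp_add]
      unfold ee
      rw [← Complex.exp_conj, ← Complex.exp_conj, ← Complex.exp_add, ← Complex.exp_add, ← Complex.exp_add]
      congr 1
      simp only [map_mul, Complex.conj_I, Complex.conj_ofReal]
      have e1 : ∑ i, z.2.1 i * X i = (∑ i, z.2.1 i * q.1.2 i) + (∑ i, z.2.1 i * q.2.2 i)
          - (∑ i, z.2.1 i * q'.1.2 i) - (∑ i, z.2.1 i * q'.2.2 i) := by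
        rw [← Finset.sum_add_distrib, ← Finset.sum_sub_distrib, ← Finset.sum_sub_distrib]
        congr 1; ext i; simp only [hX]; ring
      have e2 : ∑ i, z.2.2 i * (J i / lam) = (∑ i, z.2.2 i * (q.1.1 i / lam)) + (∑ i, z.2.2 i * (q.2.1 i / lam))
          - (∑ i, z.2.2 i * (q'.1.1 i / lam)) - (∑ i, z.2.2 i * (q'.2.1 i / lam)) := by
        rw [← Finset.sum_add_distrib, ← Finset.sum_sub_distrib, ← Finset.sum_sub_distrib]
        congr 1; ext i; simp only [hJ]; push_cast; ring
      rw [← Finset.mul_sum, ← Finset.mul_sum, ← Complex.ofReal_sum, ← Complex.ofReal_sum, e1, e2]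
      simp only [hT, sqk]
      push_cast; ring
    rw [map_mul, map_mul, Complex.conj_ofReal, Finset.prod_mul_distrib]
    linear_combination (((rho ε z : ℝ) : ℂ) * (rho ε z : ℝ)) * h2 + (Complex.exp (Complex.I * ((z.1 * T : ℝ) : ℂ)) * ((∏ i, Complex.exp (Complex.I * ((z.2.1 i * X i : ℝ) : ℂ)))
          * (∏ i, Complex.exp (Complex.I * ((z.2.2 i * (J i / lam) : ℝ) : ℂ))))) * h1
  simp_rw [hpt]
  unfold nuS
  rw [integral_prod_mul (fun t : ℝ => Complex.exp (Complex.I * ((t * T : ℝ) : ℂ)) * ((Real.exp (-ε * t ^ 2) : ℝ) : ℂ))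
    (fun w : (Fin m → ℝ) × (Fin n → ℝ) => (∏ i, (Complex.exp (Complex.I * ((w.1 i * X i : ℝ) : ℂ)) * ((Real.exp (-ε * (w.1 i) ^ 2) : ℝ) : ℂ))) *
       (∏ i, Complex.exp (Complex.I * ((w.2 i * (J i / lam) : ℝ) : ℂ)))),
    integral_prod_mul (fun x : Fin m → ℝ => ∏ i, (Complex.exp (Complex.I * ((x i * X i : ℝ) : ℂ)) * ((Real.exp (-ε * (x i) ^ 2) : ℝ) : ℂ)))
      (fun y : Fin n → ℝ => ∏ i, Complex.exp (Complex.I * ((y i * (J i / lam) : ℝ) : ℂ))),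
    integral_fintype_prod_volume_eq_prod (fun i (x : ℝ) => Complex.exp (Complex.I * ((x * X i : ℝ) : ℂ)) * ((Real.exp (-ε * x ^ 2) : ℝ) : ℂ))]
  have hbox : (volume : Measure (Fin n → ℝ)).restrict (torusBox lam n) =
      Measure.pi (fun _ => (volume : Measure ℝ).restrict (Set.Icc 0 (2 * Real.pi * lam))) := by
    unfold torusBox
    rw [← Measure.restrict_pi_pi, Set.pi_univ_Icc]; rfl
  rw [hbox, integral_fintype_prod_eq_prod (fun i (y : ℝ) => Complex.exp (Complex.I * ((y * (J i / lam) : ℝ) : ℂ)))]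
  rw [norm_mul, norm_mul, norm_prod, norm_prod, gauss_ft hε]
  simp_rw [gauss_ft hε, torus_ft hl]
  rfl

lemma gh_neg (ε τ : ℝ) : gh ε (-τ) = gh ε τ := by unfold gh; simp

lemma lintegral_muF {m n : ℕ} (f : Fq m n → ℝ≥0∞) (hf : Measurable f) :
    ∫⁻ k, f k ∂(muF m n) = ∑' j, ∫⁻ ζ, f (j, ζ) := by
  unfold muF
  rw [lintegral_prod _ hf.aemeasurable, lintegral_count]

def RB {m n : ℕ} (M : ℝ) (B : Finset (Fin n → ℤ)) : Set (Fq m n) := {k | k.1 ∈ B ∧ k.2 ∈ cube m M}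

lemma RB_meas {m n : ℕ} (M : ℝ) (B : Finset (Fin n → ℤ)) : MeasurableSet (RB M B : Set (Fq m n)) := by
  have : (RB M B : Set (Fq m n)) = (B : Set (Fin n → ℤ)) ×ˢ (cube m M) := by
    ext k; simp [RB]
  rw [this]
  exact B.measurableSet.prod (measurableSet_cube _ _)

def bilC (lam M : ℝ) (k n c : ℕ) : ℝ≥0∞ := (c : ℝ≥0∞) * (ENNReal.ofReal (2 * Real.pi * lam) ^ n *
  (ENNReal.ofReal ((2 * Real.pi) ^ (k + 2)) * (ENNReal.ofReal (2 * M) ^ k *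
    (ENNReal.ofReal (2 * Real.pi) * ENNReal.ofReal (2 * Real.pi)))))

lemma sqk_meas (lam : ℝ) {m n : ℕ} : Measurable (fun k : Fq m n => sqk lam k) := by
  unfold sqk
  have hj : ∀ i, Measurable (fun r : Fq m n => ((r.1 i : ℤ) : ℝ)) := by
    intro i
    have : Measurable (fun j : ℤ => (j:ℝ)) := measurable_from_top
    exact this.comp (by fun_prop)
  fun_prop

lemma kernel_bound {ε lam : ℝ} (hε : 0 < ε) (hl : 0 < lam) {k n : ℕ} (M : ℝ) (B : Finset (Fin n → ℤ))
    (q : Fq (k+2) n × Fq (k+2) n) :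
    ∫⁻ q' in Prod.snd ⁻¹' (RB M B), ‖∫ z, (ee lam z q.1 * ee lam z q.2 * (rho ε z : ℂ)) *
      (starRingEnd ℂ) (ee lam z q'.1 * ee lam z q'.2 * (rho ε z : ℂ)) ∂(nuS lam (k+2) n)‖ₑ
        ∂((muF (k+2) n).prod (muF (k+2) n))
      ≤ bilC lam M k n B.card := by
  set c := sqk lam q.1 + sqk lam q.2 with hc
  set ξ : Fin (k+2) → ℝ := fun i => q.1.2 i + q.2.2 i with hξ
  set J0 : Fin n → ℤ := q.1.1 + q.2.1 with hJ0
  set G : ℝ → ℝ≥0∞ := fun τ => ENNReal.ofReal (gh ε τ) with hG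
  set H : (Fin (k+2) → ℝ) → ℝ≥0∞ := fun ζ => ENNReal.ofReal (∏ i, gh ε (ζ i - ξ i)) with hH
  have hghm := gh_meas ε
  have hGm : Measurable G := by fun_prop
  have hHm : Measurable H := by fun_prop
  set P : ℝ≥0∞ := ENNReal.ofReal (2 * Real.pi * lam) ^ n with hP
  have hker : ∀ q' : Fq (k+2) n × Fq (k+2) n, ‖∫ z, (ee lam z q.1 * ee lam z q.2 * (rho ε z : ℂ)) *
      (starRingEnd ℂ) (ee lam z q'.1 * ee lam z q'.2 * (rho ε z : ℂ)) ∂(nuS lam (k+2) n)‖ₑ =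
      (if q'.1.1 = J0 - q'.2.1 then P else 0) * (H (q'.1.2 + q'.2.2) * G (sqk lam q'.1 + sqk lam q'.2 - c)) := by
    intro q'
    rw [← ofReal_norm, kernel_eq hε hl, ENNReal.ofReal_mul (gh_nonneg _ _),
      ENNReal.ofReal_mul (Finset.prod_nonneg fun i _ => gh_nonneg _ _)]
    have h1 : (∏ i, gh ε ((q.1.2 i + q.2.2 i) - (q'.1.2 i + q'.2.2 i))) = ∏ i, gh ε ((q'.1.2 + q'.2.2) i - ξ i) := by
      congr 1; ext i
      rw [← gh_neg]; congr 1; simp [hξ]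
    have h2 : ENNReal.ofReal (∏ i, if (q.1.1 i + q.2.1 i) - (q'.1.1 i + q'.2.1 i) = 0 then 2 * Real.pi * lam else 0)
        = if q'.1.1 = J0 - q'.2.1 then P else 0 := by
      split_ifs with h
      · have : ∀ i, (q.1.1 i + q.2.1 i) - (q'.1.1 i + q'.2.1 i) = 0 := by
          intro i; rw [h]; simp [hJ0]
        simp only [this, if_true, Finset.prod_const, Finset.card_univ, Fintype.card_fin]
        rw [ENNReal.ofReal_pow (by positivity)]
      · have : ∃ i, (q.1.1 i + q.2.1 i) - (q'.1.1 i + q'.2.1 i) ≠ 0 := by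
          by_contra hcon
          push Not at hcon
          apply h; ext i
          have := hcon i
          simp only [hJ0, Pi.sub_apply, Pi.add_apply]; omega
        obtain ⟨i, hi⟩ := this
        rw [Finset.prod_eq_zero (Finset.mem_univ i) (by simp [hi])]; simp
    rw [h1, h2]
    simp only [hG, hH, hc]; ring
  simp_rw [hker]
  have hs := sqk_meas lam (m := k+2) (n := n)
  have hmeas : Measurable (fun q' : Fq (k+2) n × Fq (k+2) n =>
     (if q'.1.1 = J0 - q'.2.1 then P else 0) * (H (q'.1.2 + q'.2.2) * G (sqk lam q'.1 + sqk lam q'.2 - c))) := by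
    apply Measurable.mul
    · apply Measurable.ite _ measurable_const measurable_const
      exact measurableSet_eq_fun (by fun_prop) (by
        have : Measurable (fun j : Fin n → ℤ => J0 - j) := measurable_of_countable _
        exact this.comp (by fun_prop))
    · fun_prop
  rw [← lintegral_indicator (measurable_snd (RB_meas M B))]
  have hmeas2 := hmeas.indicator (measurable_snd (RB_meas (m := k+2) M B) : MeasurableSet (Prod.snd ⁻¹' (RB M B : Set (Fq (k+2) n)) : Set (Fq (k+2) n × Fq (k+2) n)))
  rw [lintegral_prod_symm _ hmeas2.aemeasurable, lintegral_muF _ hmeas2.lintegral_prod_left']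
  set D : ℝ≥0∞ := P * ((∫⁻ ζ, H ζ) * (ENNReal.ofReal (2 * M) ^ k * (ENNReal.ofReal (2 * Real.pi) * ∫⁻ r, G r))) with hD
  have hinner : ∀ j₂ : Fin n → ℤ, ∀ ζ₂ : Fin (k+2) → ℝ, (∫⁻ x : Fq (k+2) n,
      (Prod.snd ⁻¹' RB M B : Set (Fq (k+2) n × Fq (k+2) n)).indicator (fun q' => (if q'.1.1 = J0 - q'.2.1 then P else 0) *
        (H (q'.1.2 + q'.2.2) * G (sqk lam q'.1 + sqk lam q'.2 - c))) (x, (j₂, ζ₂)) ∂(muF (k+2) n)) =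
      if j₂ ∈ B then (cube (k+2) M).indicator (fun ζ₂ => P * ∫⁻ ζ₁, H (ζ₁ + ζ₂) * G ((∑ i, ζ₁ i ^ 2) + (∑ i, ζ₂ i ^ 2)
        + ((∑ i, (((J0 - j₂) i : ℤ) / lam : ℝ) ^ 2) + (∑ i, ((j₂ i : ℤ) / lam : ℝ) ^ 2) - c))) ζ₂ else 0 := by
    intro j₂ ζ₂
    by_cases hb : j₂ ∈ B
    · by_cases hz : ζ₂ ∈ cube (k+2) M
      · rw [if_pos hb, Set.indicator_of_mem hz]
        refine (lintegral_muF _ (by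
          exact hmeas2.comp (by fun_prop : Measurable (fun x : Fq (k+2) n => (x, ((j₂, ζ₂) : Fq (k+2) n)))))).trans ?_
        have hin : ∀ x : Fq (k+2) n, (x, (j₂, ζ₂)) ∈ (Prod.snd ⁻¹' RB M B : Set (Fq (k+2) n × Fq (k+2) n)) := fun x => ⟨hb, hz⟩
        simp_rw [Set.indicator_of_mem (hin _)]
        rw [tsum_eq_single (J0 - j₂)]
        · simp only [if_true]
          rw [lintegral_const_mul _ (by fun_prop)]
          congr 2; ext ζ₁
          congr 2
          simp only [sqk]; ring
        · intro j hj
          simp [hj]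
      · have hin : ∀ x : Fq (k+2) n, (x, (j₂, ζ₂)) ∉ (Prod.snd ⁻¹' RB M B : Set (Fq (k+2) n × Fq (k+2) n)) := fun x h => hz h.2
        simp_rw [Set.indicator_of_notMem (hin _)]
        simp [hz]
    · have hin : ∀ x : Fq (k+2) n, (x, (j₂, ζ₂)) ∉ (Prod.snd ⁻¹' RB M B : Set (Fq (k+2) n × Fq (k+2) n)) := fun x h => hb h.1
      simp_rw [Set.indicator_of_notMem (hin _)]
      simp [hb]
  simp_rw [hinner]
  rw [tsum_eq_sum (s := B) (by intro j hj; simp [hj])]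
  calc _ ≤ ∑ j ∈ B, D := by
        apply Finset.sum_le_sum
        intro j hj
        simp only [if_pos hj]
        rw [lintegral_indicator (measurableSet_cube _ _), lintegral_const_mul _ (by
          apply Measurable.lintegral_prod_right' (f := fun r : (Fin (k+2) → ℝ) × (Fin (k+2) → ℝ) => H (r.2 + r.1) * G ((∑ i, r.2 i ^ 2) + (∑ i, r.1 i ^ 2)
        + ((∑ i, (((J0 - j) i : ℤ) / lam : ℝ) ^ 2) + (∑ i, ((j i : ℤ) / lam : ℝ) ^ 2) - c)))
          fun_prop)]
        rw [hD]
        gcongr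
        exact euclid_bound k M G hGm H hHm _
    _ = _ := by
        rw [Finset.sum_const, nsmul_eq_mul, hD, gh_lintegral hε, gh_lintegral_pi hε]
        rfl

lemma uu_meas (lam : ℝ) {m n : ℕ} (g : Fq m n → ℂ) (hg : Measurable g) : Measurable (uu lam g) := by
  apply StronglyMeasurable.measurable
  apply StronglyMeasurable.integral_prod_right (f := fun z k => g k * ee lam z k)
  exact ((hg.comp measurable_snd).mul (ee_meas lam)).stronglyMeasurable


lemma rho_meas (ε : ℝ) {m n : ℕ} : Measurable (fun z : Sp m n => (rho ε z : ℂ)) := by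
  unfold rho; fun_prop

lemma E_meas (lam ε : ℝ) {m n : ℕ} : Measurable (Function.uncurry (fun (z : Sp m n) (q : Fq m n × Fq m n) =>
        ee lam z q.1 * ee lam z q.2 * (rho ε z : ℂ))) := by
  have b1 : Measurable (fun r : Sp m n × (Fq m n × Fq m n) => r.1) := measurable_fst
  have b2 : Measurable (fun r : Sp m n × (Fq m n × Fq m n) => r.2.1) := measurable_snd.fst
  have b3 : Measurable (fun r : Sp m n × (Fq m n × Fq m n) => r.2.2) := measurable_snd.snd
  have a1 := ee_meas_comp lam _ _ b1 b2
  have a2 := ee_meas_comp lam _ _ b1 b3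
  have a3 := (rho_meas ε (m := m) (n := n)).comp b1
  exact (a1.mul a2).mul a3

set_option maxHeartbeats 400000 in
theorem bilinear {lam : ℝ} (hl : 0 < lam) {k n : ℕ} (M : ℝ) (B : Finset (Fin n → ℤ))
    (g₁ g₂ : Fq (k+2) n → ℂ) (hm₁ : Measurable g₁) (hm₂ : Measurable g₂)
    (hi₁ : Integrable g₁ (muF _ _)) (hi₂ : Integrable g₂ (muF _ _)) (hs : ∀ x, x ∉ RB M B → g₂ x = 0) :
    ∫⁻ z, ‖uu lam g₁ z * uu lam g₂ z‖ₑ ^ 2 ∂(nuS lam (k+2) n) ≤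
      bilC lam M k n B.card * ((∫⁻ x, ‖g₁ x‖ₑ ^ 2 ∂(muF (k+2) n)) * (∫⁻ x, ‖g₂ x‖ₑ ^ 2 ∂(muF (k+2) n))) := by
  have key : ∀ ε : ℝ, 0 < ε → ∫⁻ z, ‖(rho ε z : ℂ) * (uu lam g₁ z * uu lam g₂ z)‖ₑ ^ 2 ∂(nuS lam (k+2) n) ≤
      bilC lam M k n B.card * ((∫⁻ x, ‖g₁ x‖ₑ ^ 2 ∂(muF (k+2) n)) * (∫⁻ x, ‖g₂ x‖ₑ ^ 2 ∂(muF (k+2) n))) := by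
    intro ε hε
    have hrm : Measurable (fun z : Sp (k+2) n => (rho ε z : ℂ)) := by unfold rho; fun_prop
    have hE : Measurable (Function.uncurry (fun (z : Sp (k+2) n) (q : Fq (k+2) n × Fq (k+2) n) =>
        ee lam z q.1 * ee lam z q.2 * (rho ε z : ℂ))) := by
      exact E_meas lam ε
    have hbd : ∀ (z : Sp (k+2) n) (q : Fq (k+2) n × Fq (k+2) n),
        ‖ee lam z q.1 * ee lam z q.2 * (rho ε z : ℂ)‖ ≤ rho ε z := by
      intro z q
      rw [norm_mul, norm_mul, ee_norm, ee_norm, Complex.norm_real, Real.norm_of_nonneg (rho_nonneg ε z)]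
      simp
    have := tt_star (nuS lam (k+2) n) ((muF (k+2) n).prod (muF (k+2) n))
      (fun z q => ee lam z q.1 * ee lam z q.2 * (rho ε z : ℂ)) hE
      (rho ε) (rho_integrable hε lam _ _)
      hbd
      (fun q => g₁ q.1 * g₂ q.2) ((hm₁.comp measurable_fst).mul (hm₂.comp measurable_snd))
      (hi₁.mul_prod hi₂) (Prod.snd ⁻¹' (RB M B)) (measurable_snd (RB_meas M B))
      (by intro q hq; simp [hs q.2 hq]) (bilC lam M k n B.card) (kernel_bound hε hl M B)
    have e1 : ∫⁻ q : Fq (k+2) n × Fq (k+2) n, ‖g₁ q.1 * g₂ q.2‖ₑ ^ 2 ∂((muF (k+2) n).prod (muF (k+2) n)) =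
        (∫⁻ x, ‖g₁ x‖ₑ ^ 2 ∂(muF (k+2) n)) * (∫⁻ x, ‖g₂ x‖ₑ ^ 2 ∂(muF (k+2) n)) := by
      simp_rw [enorm_mul, mul_pow]
      exact lintegral_prod_mul (hm₁.enorm.pow_const 2).aemeasurable (hm₂.enorm.pow_const 2).aemeasurable
    rw [e1] at this
    refine le_trans (le_of_eq ?_) this
    congr 1; ext z; congr 2
    unfold uu
    rw [← integral_prod_mul, ← integral_const_mul]
    congr 1; ext q; ring
  set V : ℝ≥0∞ := _ with hV
  set A : Sp (k+2) n → ℂ := fun z => uu lam g₁ z * uu lam g₂ z with hA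
  have hAm : Measurable A := (uu_meas lam g₁ hm₁).mul (uu_meas lam g₂ hm₂)
  let f : ℕ → Sp (k+2) n → ℝ≥0∞ := fun N z => ‖(rho (1 / ((N:ℝ) + 1)) z : ℂ) * A z‖ₑ ^ 2
  have hlim : ∀ z, Filter.Tendsto (fun N => f N z) Filter.atTop (nhds (‖A z‖ₑ ^ 2)) := by
    intro z
    have h1 : Filter.Tendsto (fun N : ℕ => (1 / ((N:ℝ) + 1))) Filter.atTop (nhds 0) :=
      tendsto_one_div_add_atTop_nhds_zero_nat
    have h2 : Continuous (fun ε : ℝ => ‖(rho ε z : ℂ) * A z‖ₑ ^ 2) := by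
      have : Continuous (fun ε : ℝ => (rho ε z : ℂ) * A z) := by unfold rho; fun_prop
      exact (ENNReal.continuous_pow 2).comp this.enorm
    have h3 := (h2.tendsto 0).comp h1
    have h4 : rho 0 z = 1 := by simp [rho]
    simp only [h4, Complex.ofReal_one, one_mul] at h3
    exact h3
  calc ∫⁻ z, ‖A z‖ₑ ^ 2 ∂(nuS lam (k+2) n) = ∫⁻ z, Filter.liminf (fun N => f N z) Filter.atTop ∂(nuS lam (k+2) n) := by
        congr 1; ext z; exact (hlim z).liminf_eq.symm
    _ ≤ Filter.liminf (fun N => ∫⁻ z, f N z ∂(nuS lam (k+2) n)) Filter.atTop := by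
        apply lintegral_liminf_le
        intro N
        have hrm : Measurable (fun z : Sp (k+2) n => (rho (1 / ((N:ℝ) + 1)) z : ℂ)) := by unfold rho; fun_prop
        exact (hrm.mul hAm).enorm.pow_const 2
    _ ≤ V := by
        refine (Filter.liminf_le_liminf (v := fun _ => V) (Filter.Eventually.of_forall fun N => ?_)).trans (le_of_eq (Filter.liminf_const _))
        exact key _ (by positivity)

lemma pair_interp {Z : Type*} [MeasurableSpace Z] (ν : Measure Z) (f : Z → ℂ) (hf : Measurable f)
    (p : ℝ) (hp : 4 ≤ p) (P Q : ℝ) (hP : 0 ≤ P) (hQ : 0 ≤ Q) (X : ℝ≥0∞)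
    (h1 : ∀ z, ‖f z‖ₑ ^ 2 ≤ ENNReal.ofReal Q * X) (h2 : ∫⁻ z, ‖f z‖ₑ ^ 2 ∂ν ≤ ENNReal.ofReal P * X) :
    (∫⁻ z, ‖f z‖ₑ ^ (p / 2) ∂ν) ^ (2 / p) ≤
      ENNReal.ofReal ((Q ^ (p / 4 - 1) * P) ^ (2 / p)) * X ^ (1 / 2 : ℝ) := by
  have hr : 0 ≤ p / 4 - 1 := by linarith
  have hp0 : 0 < p := by linarith
  have h3 : ∀ z, ‖f z‖ₑ ^ (p / 2) ≤ (ENNReal.ofReal Q * X) ^ (p / 4 - 1) * ‖f z‖ₑ ^ 2 := by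
    intro z
    have : ‖f z‖ₑ ^ (p / 2) = (‖f z‖ₑ ^ 2) ^ (p / 4 - 1) * ‖f z‖ₑ ^ 2 := by
      rw [← ENNReal.rpow_natCast, ← ENNReal.rpow_mul, ← ENNReal.rpow_add_of_nonneg _ _ (by positivity) (by positivity)]
      congr 1; push_cast; ring
    rw [this]
    gcongr
    exact h1 z
  have h4 : ∫⁻ z, ‖f z‖ₑ ^ (p / 2) ∂ν ≤ ENNReal.ofReal (Q ^ (p / 4 - 1) * P) * X ^ (p / 4) := by
    calc _ ≤ ∫⁻ z, (ENNReal.ofReal Q * X) ^ (p / 4 - 1) * ‖f z‖ₑ ^ 2 ∂ν := lintegral_mono h3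
      _ = (ENNReal.ofReal Q * X) ^ (p / 4 - 1) * ∫⁻ z, ‖f z‖ₑ ^ 2 ∂ν :=
          lintegral_const_mul _ (hf.enorm.pow_const 2)
      _ ≤ (ENNReal.ofReal Q * X) ^ (p / 4 - 1) * (ENNReal.ofReal P * X) := by gcongr
      _ = _ := by
          rw [ENNReal.mul_rpow_of_nonneg _ _ hr, ENNReal.ofReal_rpow_of_nonneg hQ hr,
            ENNReal.ofReal_mul (by positivity)]
          have : X ^ (p / 4) = X ^ (p / 4 - 1) * X := by
            nth_rewrite 3 [← ENNReal.rpow_one X]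
            rw [← ENNReal.rpow_add_of_nonneg _ _ hr (by norm_num)]
            congr 1; ring
          rw [this]; ring
  calc _ ≤ (ENNReal.ofReal (Q ^ (p / 4 - 1) * P) * X ^ (p / 4)) ^ (2 / p) := by gcongr
    _ = _ := by
      rw [ENNReal.mul_rpow_of_nonneg _ _ (by positivity), ← ENNReal.rpow_mul,
        ENNReal.ofReal_rpow_of_nonneg (by positivity) (by positivity)]
      congr 2
      field_simp; norm_num

def lev (lam : ℝ) {m n : ℕ} (k : Fq m n) : ℕ := Nat.log 4 ⌊1 + sqk lam k⌋₊

lemma sqk_nonneg (lam : ℝ) {m n : ℕ} (k : Fq m n) : 0 ≤ sqk lam k := by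
  unfold sqk; positivity

lemma lev_lower (lam : ℝ) {m n : ℕ} (k : Fq m n) : (4:ℝ) ^ lev lam k ≤ 1 + sqk lam k := by
  have h0 := sqk_nonneg lam k
  have h1 : ⌊1 + sqk lam k⌋₊ ≠ 0 := by
    have : 1 ≤ ⌊1 + sqk lam k⌋₊ := Nat.le_floor (by push_cast; linarith)
    omega
  have h2 := Nat.pow_log_le_self 4 h1
  have h3 := Nat.floor_le (by linarith : 0 ≤ 1 + sqk lam k)
  calc (4:ℝ) ^ lev lam k = ((4 ^ lev lam k : ℕ) : ℝ) := by push_cast; rfl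
    _ ≤ (⌊1 + sqk lam k⌋₊ : ℝ) := by exact_mod_cast h2
    _ ≤ _ := h3

lemma lev_upper (lam : ℝ) {m n : ℕ} (k : Fq m n) : 1 + sqk lam k < (4:ℝ) ^ (lev lam k + 1) := by
  have h2 : ⌊1 + sqk lam k⌋₊ < 4 ^ (lev lam k + 1) := Nat.lt_pow_succ_log_self (by norm_num) _
  have := Nat.lt_of_floor_lt h2
  exact_mod_cast this

lemma lev_meas (lam : ℝ) {m n : ℕ} : Measurable (fun k : Fq m n => lev lam k) := by
  have h1 : Measurable (fun k : Fq m n => 1 + sqk lam k) := (sqk_meas lam).const_add 1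
  have h2 : Measurable (fun x : ℝ => Nat.log 4 ⌊x⌋₊) :=
    (measurable_from_top : Measurable (Nat.log 4)).comp Nat.measurable_floor
  exact h2.comp h1

def Bset (lam : ℝ) (n a : ℕ) : Finset (Fin n → ℤ) :=
  Fintype.piFinset (fun _ => Finset.Icc (-⌊lam * 2 ^ (a + 1)⌋) ⌊lam * 2 ^ (a + 1)⌋)

def Mr (a : ℕ) : ℝ := 2 ^ (a + 1)

lemma Bset_card {lam : ℝ} (hl : 1 ≤ lam) (n a : ℕ) :
    ((Bset lam n a).card : ℝ≥0∞) ≤ ENNReal.ofReal ((6 * lam * 2 ^ a) ^ n) := by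
  unfold Bset
  have hpa : (1:ℝ) ≤ 2 ^ a := one_le_pow₀ (by norm_num)
  have h1 : (1:ℝ) ≤ lam * 2 ^ a := by nlinarith
  rw [Fintype.card_piFinset, Finset.prod_const, Finset.card_univ, Fintype.card_fin, Int.card_Icc,
    Nat.cast_pow, ENNReal.ofReal_pow (by positivity)]
  gcongr
  rw [← ENNReal.ofReal_natCast]
  apply ENNReal.ofReal_le_ofReal
  set L := ⌊lam * 2 ^ (a + 1)⌋ with hL
  have hL0 : 0 ≤ L := Int.floor_nonneg.2 (by positivity)
  have hL1 : (L:ℝ) ≤ lam * 2 ^ (a+1) := Int.floor_le _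
  have : (((L + 1 - -L).toNat : ℕ) : ℝ) = 2 * L + 1 := by
    have h : (((L + 1 - -L).toNat : ℕ) : ℤ) = 2 * L + 1 := by omega
    exact_mod_cast h
  rw [this]
  rw [pow_succ] at hL1
  nlinarith

lemma lev_region {lam : ℝ} (hl : 1 ≤ lam) {m n : ℕ} (k : Fq m n) :
    k ∈ (RB (Mr (lev lam k)) (Bset lam n (lev lam k)) : Set (Fq m n)) := by
  set a := lev lam k with ha
  have hu := lev_upper lam k
  rw [← ha] at hu
  have h4 : (4:ℝ) ^ (a+1) = (2 ^ (a+1)) ^ 2 := by rw [← pow_mul, mul_comm, pow_mul]; norm_num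
  have hpos : (0:ℝ) ≤ 2 ^ (a+1) := by positivity
  have hl0 : 0 < lam := by linarith
  unfold sqk at hu
  constructor
  · unfold Bset
    rw [Fintype.mem_piFinset]
    intro i
    have h1 : ((k.1 i : ℝ) / lam) ^ 2 ≤ ∑ i, ((k.1 i : ℝ) / lam) ^ 2 :=
      Finset.single_le_sum (f := fun i => ((k.1 i : ℝ) / lam) ^ 2) (fun i _ => sq_nonneg _) (Finset.mem_univ i)
    have h2 : 0 ≤ ∑ i, (k.2 i) ^ 2 := Finset.sum_nonneg fun i _ => sq_nonneg _
    have h3 : |(k.1 i : ℝ) / lam| ≤ 2 ^ (a+1) := abs_le_of_sq_le_sq (by linarith) hpos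
    rw [abs_div, abs_of_pos hl0, div_le_iff₀ hl0, mul_comm, abs_le] at h3
    rw [Finset.mem_Icc]
    constructor
    · have : -k.1 i ≤ ⌊lam * 2 ^ (a + 1)⌋ := Int.le_floor.2 (by push_cast; linarith)
      linarith
    · exact Int.le_floor.2 (by linarith)
  · intro i
    have h1 : (k.2 i) ^ 2 ≤ ∑ i, (k.2 i) ^ 2 :=
      Finset.single_le_sum (f := fun i => (k.2 i) ^ 2) (fun i _ => sq_nonneg _) (Finset.mem_univ i)
    have h2 : 0 ≤ ∑ i, ((k.1 i : ℝ) / lam) ^ 2 := Finset.sum_nonneg fun i _ => sq_nonneg _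
    have h3 : |k.2 i| ≤ (2:ℝ) ^ (a+1) := abs_le_of_sq_le_sq (by linarith) hpos
    exact h3

lemma muF_RB {m n : ℕ} (M : ℝ) (B : Finset (Fin n → ℤ)) :
    muF m n (RB M B) = B.card * ENNReal.ofReal (2 * M) ^ m := by
  have : (RB M B : Set (Fq m n)) = (B : Set (Fin n → ℤ)) ×ˢ (cube m M) := by
    ext k; simp [RB]
  rw [this, muF, Measure.prod_prod, volume_cube, Measure.count_apply_finset]

def piece (lam : ℝ) {m n : ℕ} (g : Fq m n → ℂ) (a : ℕ) : Fq m n → ℂ :=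
  fun k => if lev lam k = a then g k else 0

lemma piece_meas (lam : ℝ) {m n : ℕ} (g : Fq m n → ℂ) (hg : Measurable g) (a : ℕ) : Measurable (piece lam g a) := by
  unfold piece
  exact Measurable.ite (lev_meas lam (measurableSet_singleton a)) hg measurable_const

lemma piece_int (lam : ℝ) {m n : ℕ} (g : Fq m n → ℂ) (hg : Measurable g) (hi : Integrable g (muF m n)) (a : ℕ) :
    Integrable (piece lam g a) (muF m n) := by
  refine hi.mono (piece_meas lam g hg a).aestronglyMeasurable (Filter.Eventually.of_forall fun k => ?_)
  unfold piece; split_ifs <;> simp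

lemma piece_supp {lam : ℝ} (hl : 1 ≤ lam) {m n : ℕ} (g : Fq m n → ℂ) (a : ℕ) (k : Fq m n)
    (hk : k ∉ RB (Mr a) (Bset lam n a)) : piece lam g a k = 0 := by
  unfold piece
  rw [if_neg]
  rintro rfl
  exact hk (lev_region hl k)

lemma sup_bound {lam : ℝ} {m n : ℕ} (g : Fq m n → ℂ) (hg : Measurable g) (S : Set (Fq m n)) (hS : MeasurableSet S)
    (hs : ∀ k, k ∉ S → g k = 0) (z : Sp m n) :
    ‖uu lam g z‖ₑ ^ 2 ≤ muF m n S * ∫⁻ k, ‖g k‖ₑ ^ 2 ∂(muF m n) := by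
  have h1 : ‖uu lam g z‖ₑ ≤ ∫⁻ k, S.indicator (fun _ => 1) k * ‖g k‖ₑ ∂(muF m n) := by
    refine (enorm_integral_le_lintegral_enorm _).trans (lintegral_mono fun k => ?_)
    have : ‖ee lam z k‖ₑ = 1 := by rw [← ofReal_norm, ee_norm]; simp
    rw [enorm_mul, this, mul_one]
    by_cases hk : k ∈ S
    · simp [hk]
    · simp [hs k hk]
  have h2 := ENNReal.lintegral_mul_le_Lp_mul_Lq (muF m n) Real.HolderConjugate.two_two
    ((measurable_const.indicator hS).aemeasurable (f := S.indicator (fun _ => (1:ℝ≥0∞)))) hg.enorm.aemeasurable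
  have h3 : ∫⁻ k, (S.indicator (fun _ => (1:ℝ≥0∞)) k) ^ (2:ℝ) ∂(muF m n) = muF m n S := by
    have : ∀ k, (S.indicator (fun _ => (1:ℝ≥0∞)) k) ^ (2:ℝ) = S.indicator (fun _ => (1:ℝ≥0∞)) k := by
      intro k; by_cases hk : k ∈ S <;> simp [hk]
    simp_rw [this]
    rw [lintegral_indicator hS]; simp
  rw [h3] at h2
  calc ‖uu lam g z‖ₑ ^ 2 ≤ (muF m n S ^ (1 / (2:ℝ)) * (∫⁻ k, ‖g k‖ₑ ^ (2:ℝ) ∂(muF m n)) ^ (1 / (2:ℝ))) ^ 2 := by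
        gcongr; exact h1.trans h2
    _ = _ := by
        rw [mul_pow, ← ENNReal.rpow_natCast, ← ENNReal.rpow_natCast, ← ENNReal.rpow_mul, ← ENNReal.rpow_mul]
        norm_num

def thet (k n : ℕ) (p : ℝ) : ℝ := 2 ^ (-((k : ℝ) + n) / p)
def Kb (k n : ℕ) : ℝ := 6 ^ n * ((2 * Real.pi) ^ n * ((2 * Real.pi) ^ (k+2) * (4 ^ k * (2 * Real.pi * (2 * Real.pi)))))
def Kp (k n : ℕ) (p : ℝ) : ℝ := (((6:ℝ) ^ n * 4 ^ (k+2)) ^ 2) ^ ((p / 4 - 1) * (2 / p)) * Kb k n ^ (2 / p)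
def ss (k n : ℕ) (p : ℝ) : ℝ := (((k + 2 : ℕ) : ℝ) + n) / 2 - ((((k + 2 : ℕ) : ℝ) + n) + 2) / p

lemma Kb_pos (k n : ℕ) : 0 < Kb k n := by unfold Kb; positivity
lemma Kp_pos (k n : ℕ) (p : ℝ) : 0 < Kp k n p := by
  have := Kb_pos k n
  unfold Kp; positivity

def Vr (lam : ℝ) (k n a : ℕ) : ℝ := (6 * lam * 2 ^ a) ^ n * (4 * 2 ^ a) ^ (k+2)
def Pr (lam : ℝ) (k n b : ℕ) : ℝ := (6 * lam * 2 ^ b) ^ n * ((2 * Real.pi * lam) ^ n * ((2 * Real.pi) ^ (k+2) *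
  ((4 * 2 ^ b) ^ k * (2 * Real.pi * (2 * Real.pi)))))

lemma expo {lam : ℝ} (hl : 1 ≤ lam) (k n : ℕ) (p : ℝ) (hp : 4 ≤ p) (a b : ℕ) (hab : b ≤ a) :
    ((Vr lam k n a * Vr lam k n b) ^ (p / 4 - 1) * Pr lam k n b) ^ (2 / p) =
      Kp k n p * lam ^ n * (2 ^ ((a:ℝ) * ss k n p) * 2 ^ ((b:ℝ) * ss k n p)) * thet k n p ^ (a - b) := by
  have hl0 : 0 < lam := by linarith
  have hp0 : 0 < p := by linarith
  have hV : ∀ a, 0 < Vr lam k n a := fun a => by unfold Vr; positivity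
  have hPp : 0 < Pr lam k n b := by unfold Pr; positivity
  have hth : 0 < thet k n p := by unfold thet; positivity
  have hK := Kb_pos k n
  have hKp := Kp_pos k n p
  have hva := hV a
  have hvb := hV b
  have lV : ∀ a, Real.log (Vr lam k n a) = Real.log ((6:ℝ)^n * 4^(k+2)) + n * Real.log lam + a * (k + 2 + n) * Real.log 2 := by
    intro a
    unfold Vr
    have : (6 * lam * 2 ^ a) ^ n * (4 * 2 ^ a) ^ (k+2) = ((6:ℝ)^n * 4^(k+2)) * lam ^ n * 2 ^ (a * (k + 2 + n)) := by
      rw [pow_mul]; ring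
    rw [this, Real.log_mul (by positivity) (by positivity), Real.log_mul (by positivity) (by positivity), Real.log_pow, Real.log_pow]
    push_cast; ring
  have lP : Real.log (Pr lam k n b) = Real.log (Kb k n) + 2 * n * Real.log lam + b * (k + n) * Real.log 2 := by
    have : Pr lam k n b = Kb k n * lam ^ (2 * n) * 2 ^ (b * (k + n)) := by
      unfold Pr Kb
      rw [pow_mul, pow_mul]; ring
    rw [this, Real.log_mul (by positivity) (by positivity), Real.log_mul (by positivity) (by positivity), Real.log_pow, Real.log_pow]
    push_cast; ring
  have lK : Real.log (Kp k n p) = (p / 4 - 1) * (2 / p) * (2 * Real.log ((6:ℝ)^n * 4^(k+2))) + 2 / p * Real.log (Kb k n) := by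
    unfold Kp
    rw [Real.log_mul (by positivity) (by positivity), Real.log_rpow (by positivity), Real.log_rpow hK, Real.log_pow]
    push_cast; ring
  have lth : Real.log (thet k n p) = -((k : ℝ) + n) / p * Real.log 2 := by
    unfold thet; rw [Real.log_rpow (by norm_num)]
  apply Real.log_injOn_pos
  · exact Set.mem_Ioi.2 (by positivity)
  · exact Set.mem_Ioi.2 (by positivity)
  rw [Real.log_rpow (by positivity), Real.log_mul (by positivity) (by positivity), Real.log_rpow (by positivity),
    Real.log_mul (by positivity) (by positivity),
    Real.log_mul (by positivity) (by positivity), Real.log_mul (by positivity) (by positivity),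
    Real.log_mul (by positivity) (by positivity), Real.log_mul (by positivity) (by positivity),
    Real.log_rpow (by norm_num), Real.log_rpow (by norm_num), Real.log_pow, Real.log_pow, lV, lV, lP, lK, lth, Nat.cast_sub hab]
  unfold ss
  push_cast
  field_simp
  ring

def XX (lam : ℝ) {m n : ℕ} (g : Fq m n → ℂ) (a : ℕ) : ℝ≥0∞ := ∫⁻ k, ‖piece lam g a k‖ₑ ^ 2 ∂(muF m n)
def YY (lam s : ℝ) {m n : ℕ} (g : Fq m n → ℂ) (a : ℕ) : ℝ≥0∞ :=
  ∫⁻ k, ENNReal.ofReal ((1 + sqk lam k) ^ s) * ‖piece lam g a k‖ₑ ^ 2 ∂(muF m n)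

lemma X_le_Y (lam s : ℝ) (hs : 0 ≤ s) {m n : ℕ} (g : Fq m n → ℂ) (a : ℕ) :
    ENNReal.ofReal (2 ^ ((a:ℝ) * s)) * (XX lam g a) ^ (1/2 : ℝ) ≤ (YY lam s g a) ^ (1/2 : ℝ) := by
  have h1 : ENNReal.ofReal (2 ^ ((a:ℝ) * s)) = (ENNReal.ofReal ((4:ℝ) ^ ((a:ℝ) * s))) ^ (1/2 : ℝ) := by
    rw [ENNReal.ofReal_rpow_of_nonneg (by positivity) (by norm_num)]
    congr 1
    rw [← Real.rpow_mul (by norm_num), show (4:ℝ) = 2 ^ (2:ℝ) by norm_num, ← Real.rpow_mul (by norm_num)]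
    congr 1; ring
  rw [h1, ← ENNReal.mul_rpow_of_nonneg _ _ (by norm_num)]
  gcongr
  unfold XX YY
  rw [← lintegral_const_mul' _ _ ENNReal.ofReal_ne_top]
  apply lintegral_mono
  intro k
  dsimp only
  by_cases h : lev lam k = a
  · gcongr
    rw [Real.rpow_mul (by norm_num), Real.rpow_natCast, ← h]
    exact Real.rpow_le_rpow (by positivity) (lev_lower lam k) hs
  · simp [piece, h]

lemma sqrt_le_add (x y : ℝ≥0∞) : x ^ (1/2:ℝ) * y ^ (1/2:ℝ) ≤ x + y := by
  have key : ∀ t : ℝ≥0∞, t ^ (1/2:ℝ) * t ^ (1/2:ℝ) = t := by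
    intro t
    rw [← ENNReal.rpow_add_of_nonneg _ _ (by norm_num) (by norm_num)]; norm_num
  rcases le_total x y with h | h
  · calc _ ≤ y ^ (1/2:ℝ) * y ^ (1/2:ℝ) := by gcongr
      _ = y := key y
      _ ≤ _ := le_add_self
  · calc _ ≤ x ^ (1/2:ℝ) * x ^ (1/2:ℝ) := by gcongr
      _ = x := key x
      _ ≤ _ := le_self_add

lemma ss_nonneg (k n : ℕ) (p : ℝ) (hp : 4 ≤ p) : 0 ≤ ss k n p := by
  unfold ss
  have : ((((k + 2 : ℕ) : ℝ) + n) + 2) / p ≤ ((((k + 2 : ℕ) : ℝ) + n) + 2) / 4 := by gcongr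
  have h2 : (0:ℝ) ≤ k := by positivity
  have h3 : (0:ℝ) ≤ n := by positivity
  push_cast at *
  linarith

lemma pair_bound {lam : ℝ} (hl : 1 ≤ lam) {k n : ℕ} (p : ℝ) (hp : 4 ≤ p) (g : Fq (k+2) n → ℂ) (hg : Measurable g)
    (hi : Integrable g (muF _ _)) (a b : ℕ) (hab : b ≤ a) :
    (∫⁻ z, ‖uu lam (piece lam g a) z * uu lam (piece lam g b) z‖ₑ ^ (p / 2) ∂(nuS lam (k+2) n)) ^ (2 / p)
      ≤ ENNReal.ofReal (Kp k n p * lam ^ n) * ENNReal.ofReal (thet k n p) ^ (a - b) *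
        (YY lam (ss k n p) g a + YY lam (ss k n p) g b) := by
  have hl0 : 0 < lam := by linarith
  have hma := piece_meas lam g hg
  have hia := piece_int lam g hg hi
  have hV0 : ∀ a, 0 ≤ Vr lam k n a := fun a => by unfold Vr; positivity
  have hP0 : 0 ≤ Pr lam k n b := by unfold Pr; positivity
  have hM : ∀ a, 2 * Mr a = 4 * 2 ^ a := fun a => by unfold Mr; rw [pow_succ]; ring
  have hV : ∀ a, muF (k+2) n (RB (Mr a) (Bset lam n a)) ≤ ENNReal.ofReal (Vr lam k n a) := by
    intro a
    rw [muF_RB, Vr, hM, ENNReal.ofReal_mul (p := (6 * lam * 2 ^ a) ^ n) (by positivity), ENNReal.ofReal_pow (p := 4 * 2 ^ a) (by positivity)]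
    gcongr
    exact Bset_card hl n a
  have hPb : bilC lam (Mr b) k n (Bset lam n b).card ≤ ENNReal.ofReal (Pr lam k n b) := by
    unfold bilC Pr
    rw [hM, ENNReal.ofReal_mul (p := (6 * lam * 2 ^ b) ^ n) (by positivity),
      ENNReal.ofReal_mul (p := (2 * Real.pi * lam) ^ n) (by positivity),
      ENNReal.ofReal_mul (p := (2 * Real.pi) ^ (k+2)) (by positivity),
      ENNReal.ofReal_mul (p := (4 * 2 ^ b) ^ k) (by positivity),
      ENNReal.ofReal_mul (p := 2 * Real.pi) (q := 2 * Real.pi) (by positivity),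
      ENNReal.ofReal_pow (p := 4 * 2 ^ b) (by positivity), ENNReal.ofReal_pow (p := 2 * Real.pi * lam) (by positivity)]
    gcongr
    exact Bset_card hl n b
  have h2 := bilinear hl0 (Mr b) (Bset lam n b) (piece lam g a) (piece lam g b) (hma a) (hma b) (hia a) (hia b)
    (piece_supp hl g b)
  have h1 : ∀ z, ‖uu lam (piece lam g a) z * uu lam (piece lam g b) z‖ₑ ^ 2 ≤
      ENNReal.ofReal (Vr lam k n a * Vr lam k n b) * (XX lam g a * XX lam g b) := by
    intro z
    have ea := sup_bound (lam := lam) _ (hma a) _ (RB_meas _ _) (piece_supp hl g a) z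
    have eb := sup_bound (lam := lam) _ (hma b) _ (RB_meas _ _) (piece_supp hl g b) z
    rw [enorm_mul, mul_pow, ENNReal.ofReal_mul (hV0 a)]
    calc _ ≤ (ENNReal.ofReal (Vr lam k n a) * XX lam g a) * (ENNReal.ofReal (Vr lam k n b) * XX lam g b) :=
          mul_le_mul' (ea.trans (mul_le_mul' (hV a) le_rfl)) (eb.trans (mul_le_mul' (hV b) le_rfl))
      _ = _ := by ring
  have h3 := pair_interp (nuS lam (k+2) n) _ ((uu_meas lam _ (hma a)).mul (uu_meas lam _ (hma b))) p hp
    (Pr lam k n b) (Vr lam k n a * Vr lam k n b) hP0 (mul_nonneg (hV0 a) (hV0 b)) (XX lam g a * XX lam g b) h1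
    (h2.trans (mul_le_mul' hPb le_rfl))
  refine h3.trans ?_
  have hth : 0 < thet k n p := by unfold thet; positivity
  have hKp := Kp_pos k n p
  rw [expo hl k n p hp a b hab, ENNReal.mul_rpow_of_nonneg _ _ (by norm_num),
    ENNReal.ofReal_mul (by positivity), ENNReal.ofReal_mul (by positivity), ENNReal.ofReal_mul (q := 2 ^ ((b:ℝ) * ss k n p)) (by positivity),
    ENNReal.ofReal_pow hth.le]
  have hs := ss_nonneg k n p hp
  calc _ = ENNReal.ofReal (Kp k n p * lam ^ n) * ENNReal.ofReal (thet k n p) ^ (a - b) *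
        ((ENNReal.ofReal (2 ^ ((a:ℝ) * ss k n p)) * (XX lam g a) ^ (1/2:ℝ)) * (ENNReal.ofReal (2 ^ ((b:ℝ) * ss k n p)) * (XX lam g b) ^ (1/2:ℝ))) := by
        ring
    _ ≤ ENNReal.ofReal (Kp k n p * lam ^ n) * ENNReal.ofReal (thet k n p) ^ (a - b) *
        ((YY lam (ss k n p) g a) ^ (1/2:ℝ) * (YY lam (ss k n p) g b) ^ (1/2:ℝ)) := by
        gcongr
        · exact X_le_Y lam _ hs g a
        · exact X_le_Y lam _ hs g b
    _ ≤ _ := by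
        gcongr
        exact sqrt_le_add _ _

lemma geo_bound (θ : ℝ≥0∞) (K a : ℕ) :
    ∑ b ∈ Finset.range K, θ ^ ((a - b) + (b - a)) ≤ 2 * (1 - θ)⁻¹ := by
  have key : ∀ (s : Finset ℕ) (f : ℕ → ℕ), Set.InjOn f s → ∑ b ∈ s, θ ^ (f b) ≤ (1 - θ)⁻¹ := by
    intro s f hf
    rw [← ENNReal.tsum_geometric, ← Finset.sum_image (f := fun i => θ ^ i) (by exact hf)]
    exact ENNReal.sum_le_tsum _
  rw [← Finset.sum_filter_add_sum_filter_not (Finset.range K) (fun b => b ≤ a), two_mul]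
  refine add_le_add (key _ _ ?_) (key _ _ ?_)
  · intro x hx y hy h
    simp at hx hy h
    omega
  · intro x hx y hy h
    simp at hx hy h
    omega

lemma YY_sum (lam s : ℝ) {m n : ℕ} (g : Fq m n → ℂ) (hg : Measurable g) (K : ℕ) :
    ∑ a ∈ Finset.range K, YY lam s g a ≤ ∫⁻ k, ENNReal.ofReal ((1 + sqk lam k) ^ s) * ‖g k‖ₑ ^ 2 ∂(muF m n) := by
  unfold YY
  have hs : Measurable (fun k : Fq m n => ENNReal.ofReal ((1 + sqk lam k) ^ s)) :=
    (((sqk_meas lam).const_add 1).pow_const s).ennreal_ofReal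
  rw [← lintegral_finsetSum (f := fun a k => ENNReal.ofReal ((1 + sqk lam k) ^ s) * ‖piece lam g a k‖ₑ ^ 2) _
    (fun a _ => hs.mul ((piece_meas lam g hg a).enorm.pow_const 2))]
  apply lintegral_mono
  intro k
  dsimp only
  rw [← Finset.mul_sum]
  gcongr
  calc _ = ∑ a ∈ Finset.range K, if lev lam k = a then ‖g k‖ₑ ^ 2 else 0 := by
        apply Finset.sum_congr rfl
        intro a _
        unfold piece
        split_ifs <;> simp
    _ ≤ _ := by
        rw [Finset.sum_ite_eq]
        split_ifs <;> simp

def Cc (k n : ℕ) (p : ℝ) : ℝ≥0∞ := 2 * (2 * (1 - ENNReal.ofReal (thet k n p))⁻¹)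

lemma Cc_ne_top (k n : ℕ) (hn : 1 ≤ n) (p : ℝ) (hp : 4 ≤ p) : Cc k n p ≠ ⊤ := by
  unfold Cc
  have h : thet k n p < 1 := by
    unfold thet
    apply Real.rpow_lt_one_of_one_lt_of_neg (by norm_num)
    have : (1:ℝ) ≤ n := by exact_mod_cast hn
    have h2 : (0:ℝ) ≤ k := by positivity
    apply div_neg_of_neg_of_pos <;> linarith
  have h3 : 1 - ENNReal.ofReal (thet k n p) ≠ 0 := by
    rw [Ne, tsub_eq_zero_iff_le, not_le]
    rwa [ENNReal.ofReal_lt_one]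
  exact ENNReal.mul_ne_top (by norm_num) (ENNReal.mul_ne_top (by norm_num) (ENNReal.inv_ne_top.2 h3))

lemma pair_bound2 {lam : ℝ} (hl : 1 ≤ lam) {k n : ℕ} (p : ℝ) (hp : 4 ≤ p) (g : Fq (k+2) n → ℂ) (hg : Measurable g)
    (hi : Integrable g (muF _ _)) (a b : ℕ) :
    (∫⁻ z, ‖uu lam (piece lam g a) z * uu lam (piece lam g b) z‖ₑ ^ (p / 2) ∂(nuS lam (k+2) n)) ^ (2 / p)
      ≤ ENNReal.ofReal (Kp k n p * lam ^ n) * ENNReal.ofReal (thet k n p) ^ ((a - b) + (b - a)) *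
        (YY lam (ss k n p) g a + YY lam (ss k n p) g b) := by
  rcases le_total b a with h | h
  · rw [Nat.sub_eq_zero_of_le h, add_zero]
    exact pair_bound hl p hp g hg hi a b h
  · rw [Nat.sub_eq_zero_of_le h, zero_add, add_comm (YY _ _ _ a)]
    simp_rw [mul_comm (uu lam (piece lam g a) _)]
    exact pair_bound hl p hp g hg hi b a h

lemma core_trunc {lam : ℝ} (hl : 1 ≤ lam) {k n : ℕ} (p : ℝ) (hp : 4 ≤ p) (g : Fq (k+2) n → ℂ) (hg : Measurable g)
    (hi : Integrable g (muF _ _)) (K : ℕ) :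
    (∫⁻ z, ‖∑ a ∈ Finset.range K, uu lam (piece lam g a) z‖ₑ ^ p ∂(nuS lam (k+2) n)) ^ (2 / p)
      ≤ ENNReal.ofReal (Kp k n p * lam ^ n) * (Cc k n p *
        ∫⁻ k', ENNReal.ofReal ((1 + sqk lam k') ^ (ss k n p)) * ‖g k'‖ₑ ^ 2 ∂(muF _ _)) := by
  have hp0 : 0 < p := by linarith
  set ν := nuS lam (k+2) n
  set U : ℕ → Sp (k+2) n → ℂ := fun a z => uu lam (piece lam g a) z with hU
  have hUm : ∀ a, Measurable (U a) := fun a => uu_meas lam _ (piece_meas lam g hg a)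
  have e1 : (∫⁻ z, ‖∑ a ∈ Finset.range K, U a z‖ₑ ^ p ∂ν) ^ (2 / p) =
      eLpNorm' (∑ q ∈ Finset.range K ×ˢ Finset.range K, fun z => U q.1 z * U q.2 z) (p / 2) ν := by
    unfold eLpNorm'
    rw [one_div_div]
    congr 1
    apply lintegral_congr
    intro z
    have e0 : ∑ x ∈ Finset.range K, ∑ y ∈ Finset.range K, U x z * U y z =
        (∑ a ∈ Finset.range K, U a z) * (∑ a ∈ Finset.range K, U a z) := (Finset.sum_mul_sum _ _ _ _).symm
    rw [Finset.sum_apply, Finset.sum_product]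
    dsimp only
    rw [e0, enorm_mul, ← pow_two, ← ENNReal.rpow_natCast,
      ← ENNReal.rpow_mul]
    congr 1; push_cast; ring
  have e2 : ∀ a b, eLpNorm' (fun z => U a z * U b z) (p / 2) ν ≤
      ENNReal.ofReal (Kp k n p * lam ^ n) * ENNReal.ofReal (thet k n p) ^ ((a - b) + (b - a)) *
        (YY lam (ss k n p) g a + YY lam (ss k n p) g b) := by
    intro a b
    unfold eLpNorm'
    rw [one_div_div]
    exact pair_bound2 hl p hp g hg hi a b
  rw [show (∫⁻ z, ‖∑ a ∈ Finset.range K, uu lam (piece lam g a) z‖ₑ ^ p ∂ν) = (∫⁻ z, ‖∑ a ∈ Finset.range K, U a z‖ₑ ^ p ∂ν) from rfl, e1]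
  refine (eLpNorm'_sum_le (fun q _ => ((hUm q.1).mul (hUm q.2)).aestronglyMeasurable) (by linarith)).trans ?_
  refine (Finset.sum_le_sum (fun q _ => e2 q.1 q.2)).trans ?_
  rw [Finset.sum_product]
  set c := ENNReal.ofReal (Kp k n p * lam ^ n)
  set θ := ENNReal.ofReal (thet k n p) with hθ
  set Y := YY lam (ss k n p) g
  have hsplit : ∀ a b, c * θ ^ ((a - b) + (b - a)) * (Y a + Y b) =
      c * (Y a * θ ^ ((a - b) + (b - a))) + c * (Y b * θ ^ ((b - a) + (a - b))) := by
    intro a b; rw [add_comm (b - a)]; ring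
  simp_rw [hsplit, Finset.sum_add_distrib]
  rw [Finset.sum_comm (f := fun a b => c * (Y b * θ ^ ((b - a) + (a - b))))]
  simp_rw [← Finset.mul_sum]
  rw [← two_mul]
  calc _ ≤ 2 * (c * ∑ a ∈ Finset.range K, Y a * (2 * (1 - θ)⁻¹)) := by
        gcongr with a _
        exact geo_bound θ K a
    _ = c * (Cc k n p * ∑ a ∈ Finset.range K, Y a) := by
        rw [← Finset.sum_mul, Cc]; ring
    _ ≤ _ := by
        gcongr
        exact YY_sum lam _ g hg K

lemma uu_lim (lam : ℝ) {m n : ℕ} (g : Fq m n → ℂ) (hg : Measurable g) (hi : Integrable g (muF m n)) (z : Sp m n) :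
    Filter.Tendsto (fun K => ∑ a ∈ Finset.range K, uu lam (piece lam g a) z) Filter.atTop (nhds (uu lam g z)) := by
  have hem : Measurable (fun k : Fq m n => ee lam z k) := ee_meas_comp lam _ _ measurable_const measurable_id
  have hps : ∀ K k, ∑ a ∈ Finset.range K, piece lam g a k = if lev lam k ∈ Finset.range K then g k else 0 := by
    intro K k
    unfold piece
    rw [Finset.sum_ite_eq]
  have h1 : ∀ K, ∑ a ∈ Finset.range K, uu lam (piece lam g a) z =
      ∫ k, (if lev lam k ∈ Finset.range K then g k else 0) * ee lam z k ∂(muF m n) := by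
    intro K
    unfold uu
    rw [← integral_finsetSum]
    · congr 1; ext k
      rw [← Finset.sum_mul, hps]
    · intro a _
      refine (piece_int lam g hg hi a).mono ((piece_meas lam g hg a).mul hem).aestronglyMeasurable
        (Filter.Eventually.of_forall fun k => ?_)
      rw [norm_mul, ee_norm, mul_one]
  simp_rw [h1]
  refine tendsto_integral_of_dominated_convergence (fun k => ‖g k‖) ?_ hi.norm ?_ ?_
  · intro K
    refine Measurable.aestronglyMeasurable (Measurable.mul (Measurable.ite ?_ hg measurable_const) hem)
    exact lev_meas lam (Finset.measurableSet _)
  · intro K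
    refine Filter.Eventually.of_forall fun k => ?_
    rw [norm_mul, ee_norm, mul_one]
    split_ifs <;> simp
  · refine Filter.Eventually.of_forall fun k => ?_
    apply tendsto_const_nhds.congr'
    filter_upwards [Filter.eventually_gt_atTop (lev lam k)] with K hK
    rw [if_pos (Finset.mem_range.2 hK)]

lemma core {lam : ℝ} (hl : 1 ≤ lam) {k n : ℕ} (p : ℝ) (hp : 4 ≤ p) (g : Fq (k+2) n → ℂ) (hg : Measurable g)
    (hi : Integrable g (muF _ _)) :
    (∫⁻ z, ‖uu lam g z‖ₑ ^ p ∂(nuS lam (k+2) n))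
      ≤ (ENNReal.ofReal (Kp k n p * lam ^ n) * (Cc k n p *
        ∫⁻ k', ENNReal.ofReal ((1 + sqk lam k') ^ (ss k n p)) * ‖g k'‖ₑ ^ 2 ∂(muF _ _))) ^ (p / 2) := by
  have hp0 : 0 < p := by linarith
  have h1 : ∀ z, ‖uu lam g z‖ₑ ^ p = Filter.liminf
      (fun K => ‖∑ a ∈ Finset.range K, uu lam (piece lam g a) z‖ₑ ^ p) Filter.atTop := by
    intro z
    have := (ENNReal.continuous_rpow_const (y := p)).continuousAt.tendsto.comp (uu_lim lam g hg hi z).enorm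
    exact this.liminf_eq.symm
  simp_rw [h1]
  refine (lintegral_liminf_le ?_).trans ?_
  · intro K
    exact (Finset.measurable_fun_sum _ (fun a _ => uu_meas lam _ (piece_meas lam g hg a))).enorm.pow_const p
  refine Filter.liminf_le_of_le (by isBoundedDefault) ?_
  intro b hb
  obtain ⟨K, hK⟩ := hb.exists
  refine hK.trans ?_
  have := ENNReal.rpow_le_rpow (core_trunc hl p hp g hg hi K) (by positivity : 0 ≤ p / 2)
  rwa [← ENNReal.rpow_mul, show 2 / p * (p / 2) = 1 by field_simp, ENNReal.rpow_one] at this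

def gm {m n : ℕ} (g : (Fin m → ℝ) → (Fin n → ℤ) → ℂ) (j : Fin n → ℤ) : (Fin m → ℝ) → ℂ :=
  if h : Integrable (fun ζ => g ζ j) then h.1.mk _ else 0

lemma gm_meas {m n : ℕ} (g : (Fin m → ℝ) → (Fin n → ℤ) → ℂ) (j : Fin n → ℤ) : Measurable (gm g j) := by
  unfold gm
  split_ifs with h
  · exact h.1.stronglyMeasurable_mk.measurable
  · exact measurable_const

lemma gm_int {m n : ℕ} (g : (Fin m → ℝ) → (Fin n → ℤ) → ℂ) (j : Fin n → ℤ) : Integrable (gm g j) := by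
  unfold gm
  split_ifs with h
  · exact h.congr h.1.ae_eq_mk
  · exact integrable_zero _ _ _

lemma gm_wave (lam : ℝ) {m n : ℕ} (g : (Fin m → ℝ) → (Fin n → ℤ) → ℂ) (j : Fin n → ℤ) (z : Sp m n) :
    ∫ ζ, g ζ j * ee lam z (j, ζ) = ∫ ζ, gm g j ζ * ee lam z (j, ζ) := by
  by_cases h : Integrable (fun ζ => g ζ j)
  · apply integral_congr_ae
    filter_upwards [h.1.ae_eq_mk] with ζ hζ
    simp only [gm, h, dif_pos]
    rw [← hζ]
  · have h0 : gm g j = 0 := by simp [gm, h]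
    rw [h0]
    simp only [Pi.zero_apply, zero_mul, integral_zero]
    apply integral_undef
    intro h2
    apply h
    have hem : Measurable (fun ζ : Fin m → ℝ => star (ee lam z ((j, ζ) : Fq m n))) :=
      continuous_star.measurable.comp (ee_meas_comp lam _ _ measurable_const (by fun_prop))
    have h3 := h2.mul_bdd (c := 1) hem.aestronglyMeasurable
      (Filter.Eventually.of_forall fun ζ => by rw [norm_star, ee_norm])
    refine h3.congr (Filter.Eventually.of_forall fun ζ => ?_)
    have : ee lam z ((j, ζ) : Fq m n) * star (ee lam z ((j, ζ) : Fq m n)) = 1 := by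
      have := Complex.mul_conj' (ee lam z ((j, ζ) : Fq m n))
      rw [ee_norm] at this
      simpa using this
    dsimp only
    rw [mul_assoc, this, mul_one]

lemma gm_le {m n : ℕ} (g : (Fin m → ℝ) → (Fin n → ℤ) → ℂ) (j : Fin n → ℤ) (w : (Fin m → ℝ) → ℝ≥0∞) :
    ∫⁻ ζ, w ζ * ‖gm g j ζ‖ₑ ^ 2 ≤ ∫⁻ ζ, w ζ * ‖g ζ j‖ₑ ^ 2 := by
  by_cases h : Integrable (fun ζ => g ζ j)
  · apply lintegral_mono_ae
    filter_upwards [h.1.ae_eq_mk] with ζ hζ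
    simp only [gm, h, dif_pos]
    rw [← hζ]
  · have h0 : gm g j = 0 := by simp [gm, h]
    rw [h0]; simp

def gF {m n : ℕ} (g : (Fin m → ℝ) → (Fin n → ℤ) → ℂ) (F : Finset (Fin n → ℤ)) : Fq m n → ℂ :=
  fun k => if k.1 ∈ F then gm g k.1 k.2 else 0

lemma gF_meas {m n : ℕ} (g : (Fin m → ℝ) → (Fin n → ℤ) → ℂ) (F : Finset (Fin n → ℤ)) : Measurable (gF g F) := by
  apply measurable_from_prod_countable_right
  intro j
  unfold gF
  dsimp only
  split_ifs
  · exact gm_meas g j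
  · exact measurable_const

lemma gF_int {m n : ℕ} (g : (Fin m → ℝ) → (Fin n → ℤ) → ℂ) (F : Finset (Fin n → ℤ)) :
    Integrable (gF g F) (muF m n) := by
  refine ⟨(gF_meas g F).aestronglyMeasurable, ?_⟩
  unfold HasFiniteIntegral
  rw [lintegral_muF _ (gF_meas g F).enorm, tsum_eq_sum (s := F)]
  · rw [ENNReal.sum_lt_top]
    intro j hj
    simp only [gF, hj, if_true]
    exact (gm_int g j).2
  · intro j hj
    simp [gF, hj]

lemma gF_wave (lam : ℝ) {m n : ℕ} (g : (Fin m → ℝ) → (Fin n → ℤ) → ℂ) (F : Finset (Fin n → ℤ)) (z : Sp m n) :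
    uu lam (gF g F) z = ∑ j ∈ F, ∫ ζ, g ζ j * ee lam z (j, ζ) := by
  have hem : Measurable (fun k : Fq m n => ee lam z k) := ee_meas_comp lam _ _ measurable_const measurable_id
  have hI : Integrable (fun k => gF g F k * ee lam z k) (muF m n) := by
    refine (gF_int g F).mono ((gF_meas g F).mul hem).aestronglyMeasurable
        (Filter.Eventually.of_forall fun k => ?_)
    rw [norm_mul, ee_norm, mul_one]
  unfold uu
  unfold muF at hI ⊢
  rw [integral_prod _ hI, integral_countable hI.integral_prod_left, tsum_eq_sum (s := F)]
  · apply Finset.sum_congr rfl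
    intro j hj
    rw [gm_wave]
    simp [gF, hj, Measure.real]
  · intro j hj
    simp [gF, hj]

lemma gF_W (lam s : ℝ) {m n : ℕ} (g : (Fin m → ℝ) → (Fin n → ℤ) → ℂ) (F : Finset (Fin n → ℤ)) :
    ∫⁻ k, ENNReal.ofReal ((1 + sqk lam k) ^ s) * ‖gF g F k‖ₑ ^ 2 ∂(muF m n) ≤
      ∑' j : Fin n → ℤ, ∫⁻ ζ : Fin m → ℝ,
            ENNReal.ofReal ((1 + ((∑ i, (ζ i) ^ 2) + ∑ i, ((j i : ℝ) / lam) ^ 2)) ^ s) * ‖g ζ j‖ₑ ^ 2 := by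
  have hs : Measurable (fun k : Fq m n => ENNReal.ofReal ((1 + sqk lam k) ^ s)) :=
    (((sqk_meas lam).const_add 1).pow_const s).ennreal_ofReal
  rw [lintegral_muF (fun k => ENNReal.ofReal ((1 + sqk lam k) ^ s) * ‖gF g F k‖ₑ ^ 2) (hs.mul ((gF_meas g F).enorm.pow_const 2))]
  refine ENNReal.tsum_le_tsum fun j => ?_
  refine le_trans (lintegral_mono fun ζ => ?_) (gm_le g j _)
  unfold gF sqk
  dsimp only
  split_ifs
  · exact le_rfl
  · simp

lemma wave_bound {lam : ℝ} (hl : 1 ≤ lam) {k n : ℕ} (p : ℝ) (hp : 4 ≤ p)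
    (g : (Fin (k+2) → ℝ) → (Fin n → ℤ) → ℂ) (W : ℝ≥0∞)
    (hW : W = ∑' j : Fin n → ℤ, ∫⁻ ζ : Fin (k+2) → ℝ,
            ENNReal.ofReal ((1 + ((∑ i, (ζ i) ^ 2) + ∑ i, ((j i : ℝ) / lam) ^ 2)) ^ (ss k n p)) * ‖g ζ j‖ₑ ^ 2) :
    ∫⁻ t : ℝ, ∫⁻ x : Fin (k+2) → ℝ, ∫⁻ y in torusBox lam n, ‖waveU lam g t x y‖ₑ ^ p ≤
      ENNReal.ofReal (1 / lam ^ n) ^ p * (ENNReal.ofReal (Kp k n p * lam ^ n) * (Cc k n p * W)) ^ (p / 2) := by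
  have hp0 : 0 < p := by linarith
  have hl0 : 0 < lam := by linarith
  obtain ⟨F, hF⟩ := (Filter.atTop : Filter (Finset (Fin n → ℤ))).exists_seq_tendsto
  set H : ℕ → Sp (k+2) n → ℝ≥0∞ := fun N z => ENNReal.ofReal (1 / lam ^ n) ^ p * ‖uu lam (gF g (F N)) z‖ₑ ^ p with hH
  have hHm : ∀ N, Measurable (H N) := fun N => ((uu_meas lam _ (gF_meas g (F N))).enorm.pow_const p).const_mul _
  have h1 : ∀ t x y, ‖waveU lam g t x y‖ₑ ^ p ≤ Filter.liminf (fun N => H N (t, x, y)) Filter.atTop := by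
    intro t x y
    have hw : waveU lam g t x y = ((1 / lam ^ n : ℝ) : ℂ) * ∑' j : Fin n → ℤ, ∫ ζ, g ζ j * ee lam (t, x, y) (j, ζ) := rfl
    have hc : ‖((1 / lam ^ n : ℝ) : ℂ)‖ₑ = ENNReal.ofReal (1 / lam ^ n) := by
      rw [← ofReal_norm, Complex.norm_real, Real.norm_of_nonneg (by positivity)]
    rw [hw, enorm_mul, hc, ENNReal.mul_rpow_of_nonneg _ _ hp0.le]
    by_cases hs : Summable (fun j : Fin n → ℤ => ∫ ζ, g ζ j * ee lam (t, x, y) (j, ζ))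
    · have h2 := hs.hasSum.comp hF
      have h3 : Filter.Tendsto (fun N => H N (t, x, y)) Filter.atTop (nhds (ENNReal.ofReal (1 / lam ^ n) ^ p *
          ‖∑' j : Fin n → ℤ, ∫ ζ, g ζ j * ee lam (t, x, y) (j, ζ)‖ₑ ^ p)) := by
        simp only [hH, gF_wave]
        refine ENNReal.Tendsto.const_mul ?_ (Or.inr (ENNReal.rpow_ne_top_of_nonneg hp0.le ENNReal.ofReal_ne_top))
        exact (ENNReal.continuous_rpow_const (y := p)).continuousAt.tendsto.comp h2.enorm
      exact h3.liminf_eq.ge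
    · rw [tsum_eq_zero_of_not_summable hs]
      simp [hp0]
  have hLm : Measurable (fun z : Sp (k+2) n => Filter.liminf (fun N => H N z) Filter.atTop) := Measurable.liminf hHm
  calc _ ≤ ∫⁻ t : ℝ, ∫⁻ x : Fin (k+2) → ℝ, ∫⁻ y in torusBox lam n, Filter.liminf (fun N => H N (t, x, y)) Filter.atTop :=
        lintegral_mono fun t => lintegral_mono fun x => lintegral_mono fun y => h1 t x y
    _ = ∫⁻ z, Filter.liminf (fun N => H N z) Filter.atTop ∂(nuS lam (k+2) n) := by
        unfold nuS
        rw [lintegral_prod _ hLm.aemeasurable]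
        apply lintegral_congr
        intro t
        rw [lintegral_prod]
        exact (hLm.comp measurable_prodMk_left).aemeasurable
    _ ≤ Filter.liminf (fun N => ∫⁻ z, H N z ∂(nuS lam (k+2) n)) Filter.atTop := lintegral_liminf_le hHm
    _ ≤ _ := by
        refine Filter.liminf_le_of_le (by isBoundedDefault) ?_
        intro b hb
        obtain ⟨N, hN⟩ := hb.exists
        refine hN.trans ?_
        simp only [hH]
        rw [lintegral_const_mul _ ((uu_meas lam _ (gF_meas g (F N))).enorm.pow_const p)]
        gcongr
        refine (core hl p hp _ (gF_meas g (F N)) (gF_int g (F N))).trans ?_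
        gcongr
        rw [hW]
        exact gF_W lam _ g (F N)

/-- **Global-in-time Sobolev–Strichartz estimate on `ℝ^m × 𝕋ⁿ_λ`, `m ≥ 2`, `p ∈ [4,∞)`.**
The right-hand side is the `H^{d/2 − (d+2)/p}` norm of the function with Fourier data `g`. -/
theorem global_sobolev_strichartz (m n : ℕ) (hm : 2 ≤ m) (hn : 1 ≤ n)
    (p : ℝ) (hp : 4 ≤ p) :
    ∃ C : ℝ, 0 < C ∧
    ∀ (lam : ℝ) (g : (Fin m → ℝ) → (Fin n → ℤ) → ℂ),
      1 ≤ lam →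
      (∫⁻ t : ℝ, ∫⁻ x : Fin m → ℝ, ∫⁻ y in torusBox lam n,
          (‖waveU lam g t x y‖₊ : ℝ≥0∞) ^ p) ^ (1 / p)
        ≤ ENNReal.ofReal C *
          (ENNReal.ofReal (1 / lam ^ n) * ∑' j : Fin n → ℤ, ∫⁻ ζ : Fin m → ℝ,
            ENNReal.ofReal ((1 + ((∑ i, (ζ i) ^ 2) + ∑ i, ((j i : ℝ) / lam) ^ 2))
                ^ (((m : ℝ) + n) / 2 - (((m : ℝ) + n) + 2) / p))
              * (‖g ζ j‖₊ : ℝ≥0∞) ^ 2) ^ (1 / 2 : ℝ) := by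
  obtain ⟨k, rfl⟩ : ∃ k, m = k + 2 := ⟨m - 2, by omega⟩
  have hp0 : 0 < p := by linarith
  set D : ℝ≥0∞ := (ENNReal.ofReal (Kp k n p) * Cc k n p) ^ (1 / 2 : ℝ) with hD
  have hDt : D ≠ ⊤ := ENNReal.rpow_ne_top_of_nonneg (by norm_num)
    (ENNReal.mul_ne_top ENNReal.ofReal_ne_top (Cc_ne_top k n hn p hp))
  refine ⟨D.toReal + 1, by positivity, ?_⟩
  intro lam g hl
  have hl0 : 0 < lam := by linarith
  have hDC : D ≤ ENNReal.ofReal (D.toReal + 1) := by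
    rw [← ENNReal.ofReal_toReal hDt, ENNReal.toReal_ofReal ENNReal.toReal_nonneg]
    exact ENNReal.ofReal_le_ofReal (by linarith)
  have h := ENNReal.rpow_le_rpow (wave_bound hl p hp g _ rfl) (by positivity : 0 ≤ 1 / p)
  refine h.trans ?_
  change _ ≤ ENNReal.ofReal (D.toReal + 1) * (ENNReal.ofReal (1 / lam ^ n) * ∑' j : Fin n → ℤ, ∫⁻ ζ : Fin (k+2) → ℝ,
            ENNReal.ofReal ((1 + ((∑ i, (ζ i) ^ 2) + ∑ i, ((j i : ℝ) / lam) ^ 2)) ^ (ss k n p)) * ‖g ζ j‖ₑ ^ 2) ^ (1 / 2 : ℝ)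
  generalize (∑' j : Fin n → ℤ, ∫⁻ ζ : Fin (k+2) → ℝ,
            ENNReal.ofReal ((1 + ((∑ i, (ζ i) ^ 2) + ∑ i, ((j i : ℝ) / lam) ^ 2)) ^ (ss k n p)) * ‖g ζ j‖ₑ ^ 2) = W
  have hK := Kp_pos k n p
  refine le_trans (le_of_eq ?_) (mul_le_mul_left hDC _)
  set c := ENNReal.ofReal (1 / lam ^ n) with hc
  have e1 : c * c * ENNReal.ofReal (Kp k n p * lam ^ n) = ENNReal.ofReal (Kp k n p) * c := by
    rw [hc, ← ENNReal.ofReal_mul (by positivity), ← ENNReal.ofReal_mul (by positivity), ← ENNReal.ofReal_mul (by positivity)]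
    congr 1
    field_simp
  have e2 : c = (c * c) ^ (1 / 2 : ℝ) := by
    rw [← pow_two, ← ENNReal.rpow_natCast, ← ENNReal.rpow_mul]
    norm_num
  rw [ENNReal.mul_rpow_of_nonneg _ _ (by positivity), ← ENNReal.rpow_mul, ← ENNReal.rpow_mul,
    show p * (1 / p) = 1 by field_simp, show p / 2 * (1 / p) = 1 / 2 by field_simp, ENNReal.rpow_one, hD,
    ← ENNReal.mul_rpow_of_nonneg _ _ (by norm_num)]
  nth_rewrite 1 [e2]
  rw [← ENNReal.mul_rpow_of_nonneg _ _ (by norm_num)]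
  congr 1
  rw [← mul_assoc, e1]
  ring
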